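/- Let P' = M'·N' be the block upper triangular parabolic subgroup, with its block diagonal Levi M' and block upper unipotent radical N', attached to a second composition of n. For every g ∈ GL_n(F_q), the image of the subspace g·V^{N'} under the quotient map V → V_{N̄} is nonzero if and only if g ∈ P̄·P_V·P'. -/

import Mathlib

open Matrix

namespace GLRep

section Group

variable {F : Type*} [Field F] {n : ℕ}

/-- The permutation matrix sending the basis vector `e j` to `e (σ j)`. -/
def permGL (F : Type*) [Field F] {n : ℕ} (σ : Equiv.Perm (Fin n)) : GL (Fin n) F where
  val := (1 : Matrix (Fin n) (Fin n) F).submatrix σ.symm id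
  inv := (1 : Matrix (Fin n) (Fin n) F).submatrix id σ.symm
  val_inv := by
    rw [← Matrix.submatrix_mul _ _ _ _ _ Function.bijective_id, mul_one,
      Matrix.submatrix_one _ σ.symm.injective]
  inv_val := by
    rw [← Matrix.submatrix_mul _ _ _ _ _ σ.symm.bijective, mul_one, Matrix.submatrix_id_id]

/-- The elementary matrix `1 + a E_{ij}`, for `i ≠ j`. -/
def elemGL (i j : Fin n) (hij : i ≠ j) (a : F) : GL (Fin n) F where
  val := transvection i j a
  inv := transvection i j (-a)
  val_inv := by simp [transvection_mul_transvection_same _ _ hij]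
  inv_val := by simp [transvection_mul_transvection_same _ _ hij]

/-- The invertible diagonal matrix with entries `t`. -/
def diagGL (t : Fin n → Fˣ) : GL (Fin n) F where
  val := diagonal fun i => (t i : F)
  inv := diagonal fun i => ((t i)⁻¹ : Fˣ)
  val_inv := by simp
  inv_val := by simp

theorem permGL_mul_apply (σ : Equiv.Perm (Fin n)) (A : Matrix (Fin n) (Fin n) F) (k l : Fin n) :
    ((permGL F σ : Matrix (Fin n) (Fin n) F) * A) k l = A (σ.symm k) l := by
  simp [permGL, Matrix.mul_apply, Matrix.one_apply]

theorem mul_permGL_apply (σ : Equiv.Perm (Fin n)) (A : Matrix (Fin n) (Fin n) F) (k l : Fin n) :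
    (A * (permGL F σ : Matrix (Fin n) (Fin n) F)) k l = A k (σ l) := by
  simp [permGL, Matrix.mul_apply, Matrix.one_apply, Equiv.symm_apply_eq]

theorem elemGL_mul_apply (i j : Fin n) (hij : i ≠ j) (a : F) (A : Matrix (Fin n) (Fin n) F)
    (k l : Fin n) :
    ((elemGL i j hij a : Matrix (Fin n) (Fin n) F) * A) k l =
      A k l + if k = i then a * A j l else 0 := by
  simp only [elemGL]
  split_ifs with h
  · subst h; simp
  · simp [h]

theorem mul_elemGL_apply (i j : Fin n) (hij : i ≠ j) (a : F) (A : Matrix (Fin n) (Fin n) F)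
    (k l : Fin n) :
    (A * (elemGL i j hij a : Matrix (Fin n) (Fin n) F)) k l =
      A k l + if l = j then a * A k i else 0 := by
  simp only [elemGL]
  split_ifs with h
  · subst h; simp
  · simp [h]

theorem diagGL_mul_apply (t : Fin n → Fˣ) (A : Matrix (Fin n) (Fin n) F) (k l : Fin n) :
    ((diagGL t : Matrix (Fin n) (Fin n) F) * A) k l = t k * A k l := by
  simp [diagGL]

theorem mul_diagGL_apply (t : Fin n → Fˣ) (A : Matrix (Fin n) (Fin n) F) (k l : Fin n) :
    (A * (diagGL t : Matrix (Fin n) (Fin n) F)) k l = A k l * t l := by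
  simp [diagGL]

theorem GL_ext {g h : GL (Fin n) F} (H : ∀ k l, (g : Matrix (Fin n) (Fin n) F) k l = h.1 k l) :
    g = h := Units.ext (Matrix.ext H)

theorem permGL_apply (σ : Equiv.Perm (Fin n)) (k l : Fin n) :
    (permGL F σ : Matrix (Fin n) (Fin n) F) k l = if k = σ l then 1 else 0 := by
  simp [permGL, Matrix.one_apply, Equiv.symm_apply_eq]

theorem elemGL_apply (i j : Fin n) (hij : i ≠ j) (a : F) (k l : Fin n) :
    (elemGL i j hij a : Matrix (Fin n) (Fin n) F) k l =
      (if k = l then 1 else 0) + if k = i then (if j = l then a else 0) else 0 := by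
  have := elemGL_mul_apply i j hij a 1 k l
  simpa [Matrix.one_apply] using this

theorem diagGL_apply (t : Fin n → Fˣ) (k l : Fin n) :
    (diagGL t : Matrix (Fin n) (Fin n) F) k l = if k = l then (t k : F) else 0 := by
  simp [diagGL, diagonal_apply]

theorem permGL_one : permGL F (1 : Equiv.Perm (Fin n)) = 1 :=
  Units.ext (Matrix.submatrix_one_equiv (1 : Equiv.Perm (Fin n)).symm)

theorem permGL_mul (σ τ : Equiv.Perm (Fin n)) : permGL F (σ * τ) = permGL F σ * permGL F τ :=
  GL_ext fun k l => by
    rw [Units.val_mul, permGL_mul_apply, permGL_apply, permGL_apply]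
    grind [Equiv.symm_apply_eq, Equiv.Perm.mul_apply]

theorem permGL_mul_elemGL (σ : Equiv.Perm (Fin n)) (i j : Fin n) (hij : i ≠ j) (a : F) :
    permGL F σ * elemGL i j hij a =
      elemGL (σ i) (σ j) (σ.injective.ne hij) a * permGL F σ :=
  GL_ext fun k l => by
    simp only [Units.val_mul, permGL_mul_apply, elemGL_mul_apply, permGL_apply, elemGL_apply,
      Equiv.symm_apply_eq, σ.injective.eq_iff, mul_ite, mul_one, mul_zero]

theorem permGL_mul_diagGL (σ : Equiv.Perm (Fin n)) (t : Fin n → Fˣ) :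
    permGL F σ * diagGL t = diagGL (t ∘ σ.symm) * permGL F σ :=
  GL_ext fun k l => by
    simp [permGL_mul_apply, diagGL_mul_apply, permGL_apply, diagGL_apply, Equiv.symm_apply_eq]

theorem diagGL_mul_permGL (σ : Equiv.Perm (Fin n)) (t : Fin n → Fˣ) :
    diagGL t * permGL F σ = permGL F σ * diagGL (t ∘ σ) := by
  rw [permGL_mul_diagGL]
  congr 2
  ext i; simp

theorem elemGL_mul_same (i j : Fin n) (hij : i ≠ j) (a b : F) :
    elemGL i j hij a * elemGL i j hij b = elemGL i j hij (a + b) :=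
  Units.ext (transvection_mul_transvection_same i j hij a b)

theorem elemGL_zero (i j : Fin n) (hij : i ≠ j) : elemGL i j hij (0 : F) = 1 :=
  Units.ext (by simp [elemGL])

theorem diagGL_mul_elemGL (t : Fin n → Fˣ) (i j : Fin n) (hij : i ≠ j) (a : F) :
    diagGL t * elemGL i j hij a = elemGL i j hij (t i * a * (t j)⁻¹) * diagGL t :=
  GL_ext fun k l => by
    rw [Units.val_mul, Units.val_mul, diagGL_mul_apply, mul_diagGL_apply, elemGL_apply,
      elemGL_apply]
    split_ifs <;> simp_all

theorem elemGL_comm (i j : Fin n) (hij : i ≠ j) (k l : Fin n) (hkl : k ≠ l) (a b : F)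
    (hil : i ≠ l) (hjk : j ≠ k) :
    elemGL i j hij a * elemGL k l hkl b = elemGL k l hkl b * elemGL i j hij a :=
  GL_ext fun u w => by
    rw [Units.val_mul, Units.val_mul, elemGL_mul_apply, mul_elemGL_apply, elemGL_apply,
      elemGL_apply, elemGL_apply]
    have := hil.symm
    grind

theorem elemGL_heis (p q r : Fin n) (hpq : p ≠ q) (hqr : q ≠ r) (hpr : p ≠ r) (a b c : F) :
    elemGL p q hpq a * elemGL p r hpr b * elemGL q r hqr c =
      elemGL q r hqr c * elemGL p r hpr (b + a * c) * elemGL p q hpq a :=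
  GL_ext fun u w => by
    simp only [mul_assoc, Units.val_mul, elemGL_mul_apply, elemGL_apply]
    grind

/-- The Bruhat identity in rank one. -/
theorem elemGL_mul_swap (i j : Fin n) (hij : i ≠ j) (a : Fˣ) :
    ∃ t : Fin n → Fˣ, elemGL i j hij (a : F) * permGL F (Equiv.swap i j) =
      elemGL j i hij.symm ((a⁻¹ : Fˣ) : F) * diagGL t * elemGL i j hij ((a⁻¹ : Fˣ) : F) := by
  refine ⟨fun k => if k = i then a else if k = j then -a⁻¹ else 1, GL_ext fun k l => ?_⟩
  rw [Units.val_mul, Units.val_mul, Units.val_mul, elemGL_mul_apply, mul_elemGL_apply,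
    elemGL_mul_apply, elemGL_mul_apply]
  simp only [permGL_apply, diagGL_apply, Equiv.swap_apply_def]
  have := a.mul_inv
  have := a.inv_mul
  grind [Units.val_neg, Units.val_one]

end Group

section Subgroups

variable {F : Type*} [Field F] {n : ℕ} {α : Type*} [LinearOrder α]

/-- Strictly block triangular matrices. -/
def StrictTriangular (b : Fin n → α) (A : Matrix (Fin n) (Fin n) F) : Prop :=
  ∀ i j, b j ≤ b i → A i j = 0

theorem StrictTriangular.mul_left {b : Fin n → α} {A B : Matrix (Fin n) (Fin n) F}
    (hA : A.BlockTriangular b) (hB : StrictTriangular b B) : StrictTriangular b (A * B) := by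
  intro i j hij
  rw [Matrix.mul_apply]
  refine Finset.sum_eq_zero fun k _ => ?_
  rcases lt_or_ge (b k) (b i) with h | h
  · rw [hA h, zero_mul]
  · rw [hB k j (hij.trans h), mul_zero]

theorem StrictTriangular.mul_right {b : Fin n → α} {A B : Matrix (Fin n) (Fin n) F}
    (hA : A.BlockTriangular b) (hB : StrictTriangular b B) : StrictTriangular b (B * A) := by
  intro i j hij
  rw [Matrix.mul_apply]
  refine Finset.sum_eq_zero fun k _ => ?_
  rcases lt_or_ge (b j) (b k) with h | h
  · rw [hA h, mul_zero]
  · rw [hB i k (h.trans hij), zero_mul]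

/-- The block triangular parabolic subgroup attached to `b`. -/
def para (F : Type*) [Field F] (b : Fin n → α) : Subgroup (GL (Fin n) F) where
  carrier := {g | (g : Matrix (Fin n) (Fin n) F).BlockTriangular b}
  mul_mem' := fun hg hh => by
    simp only [Set.mem_ofPred_eq, Units.val_mul] at *
    exact hg.mul hh
  one_mem' := blockTriangular_one
  inv_mem' := fun {g} hg => by
    simp only [Set.mem_ofPred_eq] at *
    rw [Matrix.coe_units_inv]
    have : Invertible (g : Matrix (Fin n) (Fin n) F) := Units.invertible g
    exact blockTriangular_inv_of_blockTriangular hg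

theorem mem_para_of_sub_one {b : Fin n → α} {g : GL (Fin n) F}
    (h : StrictTriangular b ((g : Matrix (Fin n) (Fin n) F) - 1)) : g ∈ para F b := by
  intro i j hij
  have := h i j hij.le
  rwa [Matrix.sub_apply, Matrix.one_apply_ne (by rintro rfl; exact lt_irrefl _ hij),
    sub_zero] at this

/-- The unipotent radical of the block triangular parabolic subgroup attached to `b`. -/
def unip (F : Type*) [Field F] (b : Fin n → α) : Subgroup (GL (Fin n) F) where
  carrier := {g | StrictTriangular b ((g : Matrix (Fin n) (Fin n) F) - 1)}
  mul_mem' := fun {g h} hg hh => by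
    have h1 := StrictTriangular.mul_left (mem_para_of_sub_one hg) hh
    intro i j hij
    have h2 := h1 i j hij
    have h3 := hg i j hij
    simp only [mul_sub, mul_one, Matrix.sub_apply, Units.val_mul] at *
    linear_combination h2 + h3
  one_mem' := by
    intro i j _
    simp
  inv_mem' := fun {g} hg => by
    have h1 := StrictTriangular.mul_left ((para F b).inv_mem (mem_para_of_sub_one hg)) hg
    intro i j hij
    have h2 := h1 i j hij
    rw [mul_sub, mul_one, ← Units.val_mul, inv_mul_cancel, Units.val_one] at h2
    rw [← neg_sub, Matrix.neg_apply, h2, neg_zero]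

theorem mem_unip {b : Fin n → α} {g : GL (Fin n) F} :
    g ∈ unip F b ↔ ∀ i j, b j ≤ b i →
      (g : Matrix (Fin n) (Fin n) F) i j = (1 : Matrix (Fin n) (Fin n) F) i j := by
  refine forall₃_congr fun i j _ => ?_
  rw [Matrix.sub_apply, sub_eq_zero]

theorem mem_unip_iff {b : Fin n → α} {g : GL (Fin n) F} :
    g ∈ unip F b ↔ (∀ i j, b j < b i → (g : Matrix (Fin n) (Fin n) F) i j = 0) ∧
      ∀ i j, b i = b j → (g : Matrix (Fin n) (Fin n) F) i j = if i = j then 1 else 0 := by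
  rw [mem_unip]
  constructor
  · refine fun h => ⟨fun i j hij => ?_, fun i j hij => by rw [h i j hij.ge, Matrix.one_apply]⟩
    rw [h i j hij.le, Matrix.one_apply_ne (by rintro rfl; exact lt_irrefl _ hij)]
  · rintro ⟨h1, h2⟩ i j hij
    rcases hij.lt_or_eq with h | h
    · rw [h1 i j h, Matrix.one_apply_ne (by rintro rfl; exact lt_irrefl _ h)]
    · rw [h2 i j h.symm, Matrix.one_apply]

theorem unip_le_para (b : Fin n → α) : unip F b ≤ para F b := fun _ => mem_para_of_sub_one

theorem conj_mem_unip {b : Fin n → α} {x g : GL (Fin n) F} (hx : x ∈ para F b)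
    (hg : g ∈ unip F b) : x * g * x⁻¹ ∈ unip F b := by
  have h1 := StrictTriangular.mul_left hx
    (StrictTriangular.mul_right ((para F b).inv_mem hx) hg)
  rw [sub_mul, one_mul, mul_sub, ← mul_assoc, ← Units.val_mul, ← Units.val_mul, ← Units.val_mul,
    mul_inv_cancel, Units.val_one] at h1
  exact h1

/-- The block diagonal Levi subgroup attached to `b`. -/
def levi (F : Type*) [Field F] (b : Fin n → α) : Subgroup (GL (Fin n) F) :=
  para F b ⊓ para F (OrderDual.toDual ∘ b)

theorem mem_levi {b : Fin n → α} {g : GL (Fin n) F} :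
    g ∈ levi F b ↔ ∀ i j, b i ≠ b j → (g : Matrix (Fin n) (Fin n) F) i j = 0 := by
  refine ⟨fun h i j hij => ?_, fun h => ⟨fun i j hij => h i j hij.ne', fun i j hij => ?_⟩⟩
  · rcases hij.lt_or_gt with h1 | h1
    · exact h.2 h1
    · exact h.1 h1
  · exact h i j (ne_of_lt hij)

theorem diagGL_mem_levi (b : Fin n → α) (t : Fin n → Fˣ) : diagGL t ∈ levi F b := by
  rw [mem_levi]
  intro i j hij
  rw [diagGL_apply, if_neg (by rintro rfl; exact hij rfl)]

theorem exists_eq_diagGL {b : Fin n → α} (hb : Function.Injective b) {g : GL (Fin n) F}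
    (hg : g ∈ levi F b) : ∃ t, g = diagGL t := by
  rw [mem_levi] at hg
  have hd : (g : Matrix (Fin n) (Fin n) F) = diagonal fun i => (g : Matrix _ _ F) i i := by
    ext i j
    rcases eq_or_ne i j with rfl | h
    · simp
    · rw [diagonal_apply_ne _ h, hg i j (hb.ne h)]
  have hdet : IsUnit (g : Matrix (Fin n) (Fin n) F).det :=
    (Matrix.isUnit_iff_isUnit_det _).1 g.isUnit
  rw [hd, det_diagonal] at hdet
  have h0 : ∀ i, (g : Matrix (Fin n) (Fin n) F) i i ≠ 0 := fun i hi =>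
    hdet.ne_zero (Finset.prod_eq_zero (Finset.mem_univ i) hi)
  refine ⟨fun i => Units.mk0 _ (h0 i), GL_ext fun k l => ?_⟩
  rw [diagGL_apply]
  conv_lhs => rw [hd]
  rw [diagonal_apply]
  rfl

theorem elemGL_mem_unip {b : Fin n → α} {i j : Fin n} (hij : i ≠ j) (h : b i < b j) (a : F) :
    elemGL i j hij a ∈ unip F b := by
  rw [mem_unip]
  intro k l hkl
  rw [elemGL_apply, Matrix.one_apply]
  grind

/-- Lower unitriangular matrices factor through the opposite parabolic subgroup. -/
theorem exists_unip_mul_levi {b : Fin n → α} (hb : Monotone b) {u : GL (Fin n) F}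
    (hu : u ∈ unip F (OrderDual.toDual : Fin n → (Fin n)ᵒᵈ)) :
    ∃ g ∈ unip F (OrderDual.toDual ∘ b), ∃ m ∈ levi F b, u = g * m := by
  rw [mem_unip] at hu
  let m₀ : Matrix (Fin n) (Fin n) F := of fun i j => if b i = b j then u.1 i j else 0
  have hm₀ : m₀.IsLowerTriangular := by
    intro i j hij
    have hij' : i < j := hij
    have : u.1 i j = 0 := by
      rw [hu i j hij'.le, Matrix.one_apply_ne hij'.ne]
    simp [m₀, this]
  have hdet : m₀.det = 1 := by
    rw [det_of_isLowerTriangular _ hm₀]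
    refine Finset.prod_eq_one fun i _ => ?_
    simp [m₀, hu i i le_rfl]
  let m : GL (Fin n) F := GeneralLinearGroup.mkOfDetNeZero m₀ (by rw [hdet]; exact one_ne_zero)
  have hmv : ∀ i j, m.1 i j = if b i = b j then u.1 i j else 0 := fun i j => rfl
  have hm : m ∈ levi F b := by
    rw [mem_levi]
    intro i j hij
    rw [hmv, if_neg hij]
  refine ⟨u * m⁻¹, ?_, m, hm, by simp⟩
  have h1 : StrictTriangular (OrderDual.toDual ∘ b) (u.1 - m.1) := by
    intro i j hij
    have hij' : b i ≤ b j := hij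
    rw [Matrix.sub_apply, hmv]
    split_ifs with h
    · exact sub_self _
    · have h2 : i < j := by
        by_contra h3
        exact h (le_antisymm hij' (hb (not_lt.1 h3)))
      rw [hu i j h2.le, Matrix.one_apply_ne h2.ne, sub_zero]
  have h2 := h1.mul_right ((para F _).inv_mem hm.2)
  rw [sub_mul, ← Units.val_mul, ← Units.val_mul, mul_inv_cancel, Units.val_one] at h2
  exact h2

theorem isPGroup_unip (p : ℕ) [Fact p.Prime] [CharP F p] :
    IsPGroup p (unip F (id : Fin n → Fin n)) := by
  rintro ⟨g, hg⟩
  have hnil : ((g : Matrix (Fin n) (Fin n) F) - 1) ^ n = 0 := by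
    have ht : ((g : Matrix (Fin n) (Fin n) F) - 1).IsUpperTriangular :=
      fun i j hij => hg i j (le_of_lt hij)
    have h1 := Matrix.aeval_self_charpoly ((g : Matrix (Fin n) (Fin n) F) - 1)
    rw [charpoly_of_isUpperTriangular _ ht, Finset.prod_congr rfl fun i _ => by
      rw [hg i i le_rfl]] at h1
    simpa using h1
  obtain ⟨k, hk⟩ : ∃ k, n ≤ p ^ k := ⟨n, (Nat.lt_pow_self (Fact.out (p := p.Prime)).one_lt).le⟩
  refine ⟨k, Subtype.ext (Units.ext ?_)⟩
  have : CharP (Matrix (Fin n) (Fin n) F) p ∨ n = 0 := by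
    rcases Nat.eq_zero_or_pos n with h | h
    · exact Or.inr h
    · have : Nonempty (Fin n) := ⟨⟨0, h⟩⟩
      exact Or.inl inferInstance
  rcases this with hc | rfl
  · have h3 : ((g : Matrix (Fin n) (Fin n) F) - 1) ^ p ^ k = 0 := pow_eq_zero_of_le hk hnil
    rw [sub_pow_char_pow_of_commute p k (Commute.one_right _), one_pow, sub_eq_zero] at h3
    simpa using h3
  · exact Subsingleton.elim _ _

theorem swap_conj_apply (i j k l : Fin n) (u : GL (Fin n) F) :
    (permGL F (Equiv.swap i j) * u * permGL F (Equiv.swap i j)).1 k l =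
      u.1 (Equiv.swap i j k) (Equiv.swap i j l) := by
  rw [Units.val_mul, mul_permGL_apply, Units.val_mul, permGL_mul_apply]
  simp

theorem swap_conj_mem_upper {i j : Fin n} (hij : (i : ℕ) + 1 = j) {u : GL (Fin n) F}
    (hu : u ∈ unip F (id : Fin n → Fin n)) (h0 : u.1 i j = 0) :
    permGL F (Equiv.swap i j) * u * permGL F (Equiv.swap i j) ∈ unip F (id : Fin n → Fin n) := by
  rw [mem_unip] at hu ⊢
  intro k l hkl
  rw [swap_conj_apply]
  simp only [id, Equiv.swap_apply_def, Matrix.one_apply] at *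
  grind

theorem swap_conj_mem_lower {i j : Fin n} (hij : (i : ℕ) + 1 = j) {u : GL (Fin n) F}
    (hu : u ∈ unip F (OrderDual.toDual : Fin n → (Fin n)ᵒᵈ)) (h0 : u.1 j i = 0) :
    permGL F (Equiv.swap i j) * u * permGL F (Equiv.swap i j) ∈
      unip F (OrderDual.toDual : Fin n → (Fin n)ᵒᵈ) := by
  rw [mem_unip] at hu ⊢
  intro k l hkl
  rw [swap_conj_apply]
  simp only [OrderDual.toDual_le_toDual, Equiv.swap_apply_def, Matrix.one_apply] at *
  grind

theorem permGL_swap_mul_self (i j : Fin n) :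
    permGL F (Equiv.swap i j) * permGL F (Equiv.swap i j) = 1 := by
  rw [← permGL_mul, Equiv.swap_mul_self, permGL_one]

/-- Generation of the general linear group by diagonal matrices, simple reflections, and one of
each pair of opposite root subgroups. -/
theorem mem_of_generators (H : Submonoid (GL (Fin n) F)) (hd : ∀ t, diagGL t ∈ H)
    (hs : ∀ i j : Fin n, (i : ℕ) + 1 = j → permGL F (Equiv.swap i j) ∈ H)
    (he : ∀ (i j : Fin n) (h : i < j), (∀ a, elemGL i j h.ne a ∈ H) ∨
      ∀ a, elemGL j i h.ne' a ∈ H) (g : GL (Fin n) F) : g ∈ H := by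
  have hp : ∀ σ : Equiv.Perm (Fin n), permGL F σ ∈ H := by
    intro σ
    cases n with
    | zero =>
      rw [Subsingleton.elim (permGL F σ) 1]; exact H.one_mem
    | succ m =>
      have hσ : σ ∈ Submonoid.closure
          (Set.range fun i : Fin m => Equiv.swap i.castSucc i.succ) := by
        rw [Equiv.Perm.mclosure_swap_castSucc_succ]; trivial
      induction hσ using Submonoid.closure_induction with
      | mem x hx => obtain ⟨i, rfl⟩ := hx; exact hs _ _ (by simp)
      | one => rw [permGL_one]; exact H.one_mem
      | mul x y _ _ h1 h2 => rw [permGL_mul]; exact H.mul_mem h1 h2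
  have hconj : ∀ (i j : Fin n) (h : i ≠ j) (a : F),
      elemGL i j h a ∈ H → elemGL j i h.symm a ∈ H := by
    intro i j h a hm
    have h1 := permGL_mul_elemGL (Equiv.swap i j) i j h a
    have h2 : elemGL j i h.symm a =
        permGL F (Equiv.swap i j) * elemGL i j h a * permGL F (Equiv.swap i j) := by
      rw [h1, mul_assoc, permGL_swap_mul_self, mul_one]
      congr 1 <;> simp
    rw [h2]
    exact H.mul_mem (H.mul_mem (hp _) hm) (hp _)
  have hall : ∀ (i j : Fin n) (h : i ≠ j) (a : F), elemGL i j h a ∈ H := by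
    intro i j h a
    rcases h.lt_or_gt with h1 | h1
    · rcases he i j h1 with h2 | h2
      · exact h2 a
      · exact hconj _ _ _ _ (h2 a)
    · rcases he j i h1 with h2 | h2
      · exact hconj _ _ _ _ (h2 a)
      · exact h2 a
  have key : ∀ A : Matrix (Fin n) (Fin n) F, A.det ≠ 0 → ∃ h ∈ H, h.1 = A := by
    intro A hA
    refine diagonal_transvection_induction_of_det_ne_zero (fun A => ∃ h ∈ H, h.1 = A) A hA
      ?_ ?_ ?_
    · intro D hD
      rw [det_diagonal, Finset.prod_ne_zero_iff] at hD
      exact ⟨_, hd fun i => Units.mk0 (D i) (hD i (Finset.mem_univ i)), by simp [diagGL]⟩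
    · intro t
      exact ⟨_, hall t.i t.j t.hij t.c, rfl⟩
    · rintro _ _ _ _ ⟨x, hx, rfl⟩ ⟨y, hy, rfl⟩
      exact ⟨x * y, H.mul_mem hx hy, rfl⟩
  obtain ⟨h, hh, hg⟩ := key g.1 ((Matrix.isUnit_iff_isUnit_det _).1 g.isUnit).ne_zero
  rwa [← Units.ext hg]

/-- Transposition on the general linear group. -/
def trGL (g : GL (Fin n) F) : GL (Fin n) F where
  val := g.1ᵀ
  inv := g⁻¹.1ᵀ
  val_inv := by rw [← transpose_mul, ← Units.val_mul, inv_mul_cancel, Units.val_one, transpose_one]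
  inv_val := by rw [← transpose_mul, ← Units.val_mul, mul_inv_cancel, Units.val_one, transpose_one]

theorem trGL_apply (g : GL (Fin n) F) (i j : Fin n) : (trGL g).1 i j = g.1 j i := rfl

theorem trGL_mul (g h : GL (Fin n) F) : trGL (g * h) = trGL h * trGL g :=
  Units.ext (transpose_mul _ _)

theorem trGL_one : trGL (1 : GL (Fin n) F) = 1 := Units.ext transpose_one

theorem trGL_trGL (g : GL (Fin n) F) : trGL (trGL g) = g := Units.ext (transpose_transpose _)

theorem trGL_diagGL (t : Fin n → Fˣ) : trGL (diagGL t) = diagGL t :=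
  Units.ext (diagonal_transpose _)

theorem trGL_mem_unip {b : Fin n → α} {g : GL (Fin n) F} :
    trGL g ∈ unip F b ↔ g ∈ unip F (OrderDual.toDual ∘ b) := by
  simp only [mem_unip, trGL_apply]
  constructor
  · intro h i j hij; rw [h j i hij, Matrix.one_apply, Matrix.one_apply]; simp only [eq_comm]
  · intro h i j hij; rw [h j i hij, Matrix.one_apply, Matrix.one_apply]; simp only [eq_comm]

theorem trGL_mem_levi {b : Fin n → α} {g : GL (Fin n) F} (hg : g ∈ levi F b) :
    trGL g ∈ levi F b := by
  rw [mem_levi] at *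
  exact fun i j hij => hg j i hij.symm

/-- The Bruhat decomposition with respect to opposite Borel subgroups. -/
theorem exists_bruhat (g : GL (Fin n) F) :
    ∃ x ∈ para F (OrderDual.toDual : Fin n → (Fin n)ᵒᵈ), ∃ σ,
      ∃ u ∈ unip F (id : Fin n → Fin n), g = x * permGL F σ * u := by
  let S : Set (GL (Fin n) F) := {g | ∃ x ∈ para F (OrderDual.toDual : Fin n → (Fin n)ᵒᵈ), ∃ σ,
      ∃ u ∈ unip F (id : Fin n → Fin n), g = x * permGL F σ * u}
  let H : Submonoid (GL (Fin n) F) :=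
    { carrier := {g | ∀ h ∈ S, h * g ∈ S}
      one_mem' := fun h hh => by rwa [mul_one]
      mul_mem' := fun {a b} ha hb h hh => by
        rw [← mul_assoc]; exact hb _ (ha _ hh) }
  have hd' : ∀ t, diagGL t ∈ para F (OrderDual.toDual : Fin n → (Fin n)ᵒᵈ) :=
    fun t => (diagGL_mem_levi _ t).1
  have hH : g ∈ H := by
    refine mem_of_generators H ?_ ?_ ?_ g
    · rintro t _ ⟨x, hx, σ, u, hu, rfl⟩
      refine ⟨x * diagGL (t ∘ σ.symm), mul_mem hx (hd' _), σ, (diagGL t)⁻¹ * u * diagGL t, ?_, ?_⟩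
      · have := conj_mem_unip ((para F id).inv_mem (diagGL_mem_levi (F := F) id t).1) hu
        rwa [inv_inv] at this
      · rw [mul_assoc x (diagGL _), ← permGL_mul_diagGL]; group
    · rintro i j hij _ ⟨x, hx, σ, u, hu, rfl⟩
      have hlt : i < j := Fin.lt_def.2 (by omega)
      set s := permGL F (Equiv.swap i j) with hs
      have hss : s * s = 1 := permGL_swap_mul_self i j
      set a := u.1 i j with ha
      set u' := elemGL i j hlt.ne (-a) * u with hu'
      have hu'm : u' ∈ unip F (id : Fin n → Fin n) :=
        mul_mem (elemGL_mem_unip hlt.ne hlt _) hu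
      have hu'0 : u'.1 i j = 0 := by
        rw [hu', Units.val_mul, elemGL_mul_apply, if_pos rfl, mem_unip.1 hu j j le_rfl,
          Matrix.one_apply_eq, ← ha]; ring
      have hsu := swap_conj_mem_upper hij hu'm hu'0
      rw [← hs] at hsu
      have hu2 : u = elemGL i j hlt.ne a * u' := by
        rw [hu', ← mul_assoc, elemGL_mul_same, add_neg_cancel, elemGL_zero, one_mul]
      have e1 : x * permGL F σ * u * s =
          x * (permGL F σ * elemGL i j hlt.ne a) * s * (s * u' * s) := by
        rw [hu2]
        simp only [mul_assoc]
        rw [← mul_assoc s s, hss, one_mul]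
      rw [e1]
      rcases lt_or_gt_of_ne (σ.injective.ne hlt.ne) with h | h
      · rcases eq_or_ne a 0 with h0 | h0
        · refine ⟨x, hx, σ * Equiv.swap i j, _, hsu, ?_⟩
          rw [h0, elemGL_zero, permGL_mul, mul_one, ← hs]; simp only [mul_assoc]
        · obtain ⟨t, ht⟩ := elemGL_mul_swap i j hlt.ne (Units.mk0 a h0)
          rw [Units.val_mk0, ← hs] at ht
          set c : F := ((Units.mk0 a h0)⁻¹ : Fˣ).1 with hc
          have hE : elemGL (σ j) (σ i) (σ.injective.ne hlt.ne') c ∈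
              para F (OrderDual.toDual : Fin n → (Fin n)ᵒᵈ) :=
            unip_le_para _ (elemGL_mem_unip (b := OrderDual.toDual) _ h _)
          refine ⟨x * (elemGL (σ j) (σ i) (σ.injective.ne hlt.ne') c * diagGL (t ∘ σ.symm)),
            mul_mem hx (mul_mem hE (hd' _)), σ, elemGL i j hlt.ne c * (s * u' * s),
            mul_mem (elemGL_mem_unip (b := id) hlt.ne hlt c) hsu, ?_⟩
          calc x * (permGL F σ * elemGL i j hlt.ne a) * s * (s * u' * s)
              = x * (permGL F σ * (elemGL i j hlt.ne a * s)) * (s * u' * s) := by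
                simp only [mul_assoc]
            _ = x * (permGL F σ * elemGL j i hlt.ne' c * diagGL t) *
                  (elemGL i j hlt.ne c * (s * u' * s)) := by
                rw [ht]; simp only [mul_assoc]
            _ = _ := by
                rw [permGL_mul_elemGL, mul_assoc _ (permGL F σ), permGL_mul_diagGL]
                simp only [mul_assoc]
      · refine ⟨x * elemGL (σ i) (σ j) (σ.injective.ne hlt.ne) a,
          mul_mem hx (unip_le_para _ (elemGL_mem_unip (b := OrderDual.toDual) _ h _)),
          σ * Equiv.swap i j, _, hsu, ?_⟩
        rw [permGL_mul_elemGL, permGL_mul, ← hs]; simp only [mul_assoc]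
    · intro i j hij
      left
      rintro a _ ⟨x, hx, σ, u, hu, rfl⟩
      exact ⟨x, hx, σ, u * elemGL i j hij.ne a,
        mul_mem hu (elemGL_mem_unip _ hij _), mul_assoc _ _ _⟩
  have h1 := hH 1 ⟨1, one_mem _, 1, 1, one_mem _, by rw [permGL_one, one_mul, one_mul]⟩
  rwa [one_mul] at h1

end Subgroups

section Linear

variable {C : Type*} [Field C] {V : Type*} [AddCommGroup V] [Module C V]

/-- A finite `p`-group acting on a nonzero vector space in characteristic `p` has a nonzero fixed
vector. -/
theorem exists_fixed_of_isPGroup {G : Type*} [Group G] [Finite G] (ρ : Representation C G V)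
    (p : ℕ) [Fact p.Prime] [CharP C p] (H : Subgroup G) (hH : IsPGroup p H)
    (K : Submodule C V) (hK : K ≠ ⊥) (hst : ∀ g ∈ H, ∀ x ∈ K, ρ g x ∈ K) :
    ∃ x ∈ K, x ≠ 0 ∧ ∀ g ∈ H, ρ g x = x := by
  obtain ⟨v, hv, hv0⟩ := Submodule.exists_mem_ne_zero_of_ne_bot hK
  let : Algebra (ZMod p) C := ZMod.algebra C p
  let : Module (ZMod p) V := Module.compHom V (algebraMap (ZMod p) C)
  have : IsScalarTower (ZMod p) C V := ⟨fun a b c => by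
    rw [Algebra.smul_def, mul_smul]; rfl⟩
  let W : Submodule (ZMod p) V := Submodule.span (ZMod p) (Set.range fun h : H => ρ h v)
  have : Module.Finite (ZMod p) W := Module.Finite.span_of_finite _ (Set.finite_range _)
  have : Finite W := Module.finite_of_finite (ZMod p)
  have hWst : ∀ g ∈ H, ∀ x ∈ W, ρ g x ∈ W := by
    intro g hg x hx
    have : W ≤ W.comap ((ρ g).restrictScalars (ZMod p)) := by
      refine Submodule.span_le.2 ?_
      rintro _ ⟨h, rfl⟩
      refine Submodule.subset_span ⟨⟨g, hg⟩ * h, ?_⟩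
      simp
    exact this hx
  have hWK : ∀ x ∈ W, x ∈ K := by
    have : W ≤ K.restrictScalars (ZMod p) := by
      refine Submodule.span_le.2 ?_
      rintro _ ⟨h, rfl⟩
      exact hst h h.2 v hv
    exact this
  let act : MulAction H W :=
    { smul := fun h x => ⟨ρ h x, hWst h h.2 x x.2⟩
      one_smul := fun x => Subtype.ext (by change ρ ((1 : H) : G) (x : V) = x; simp)
      mul_smul := fun a b x => Subtype.ext (by
        change ρ ((a * b : H) : G) (x : V) = ρ a (ρ b x); simp) }
  have hsm : ∀ (h : H) (x : W), ((h • x : W) : V) = ρ h x := fun _ _ => rfl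
  have hvW : v ∈ W := Submodule.subset_span ⟨1, by simp⟩
  have hnt : Nontrivial W := ⟨⟨v, hvW⟩, 0, fun h => hv0 (congrArg Subtype.val h)⟩
  have hdvd : p ∣ Nat.card W := by
    have h1 : Nat.card W = p ^ Module.finrank (ZMod p) W := by
      rw [Module.natCard_eq_pow_finrank (K := ZMod p), Nat.card_zmod]
    rw [h1]
    exact dvd_pow_self p Module.finrank_pos.ne'
  obtain ⟨x, hx, hx0⟩ := hH.exists_fixed_point_of_prime_dvd_card_of_fixed_point W hdvd
    (a := 0) (fun h => Subtype.ext (by rw [hsm]; simp))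
  refine ⟨x, hWK x x.2, fun h => hx0 (Subtype.ext h.symm), fun g hg => ?_⟩
  exact congrArg Subtype.val (hx ⟨g, hg⟩)

/-- A commuting family of endomorphisms over an algebraically closed field has a common
eigenvector in every nonzero stable subspace. -/
theorem exists_common_eigenvector [IsAlgClosed C] [FiniteDimensional C V] {ι : Type*}
    (f : ι → Module.End C V) (hcomm : ∀ i j, Commute (f i) (f j)) (E : Submodule C V)
    (hE : E ≠ ⊥) (hst : ∀ i, ∀ x ∈ E, f i x ∈ E) :
    ∃ x ∈ E, x ≠ 0 ∧ ∀ i, ∃ c : C, f i x = c • x := by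
  induction h : Module.finrank C E using Nat.strong_induction_on generalizing E with
  | _ d ih =>
    subst h
    by_cases hs : ∀ i, ∃ c : C, ∀ x ∈ E, f i x = c • x
    · obtain ⟨x, hx, hx0⟩ := Submodule.exists_mem_ne_zero_of_ne_bot hE
      exact ⟨x, hx, hx0, fun i => (hs i).imp fun c hc => hc x hx⟩
    · push Not at hs
      obtain ⟨i, hi⟩ := hs
      have : Nontrivial E := Submodule.nontrivial_iff_ne_bot.2 hE
      obtain ⟨μ, hμ⟩ := Module.End.exists_eigenvalue ((f i).restrict (hst i))
      obtain ⟨y, hy⟩ := hμ.exists_hasEigenvector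
      have hy1 : f i y = μ • (y : V) := congrArg Subtype.val hy.apply_eq_smul
      let E' : Submodule C V := E ⊓ LinearMap.ker (f i - μ • LinearMap.id)
      have hmem : ∀ x, x ∈ E' ↔ x ∈ E ∧ f i x = μ • x := fun x => by
        simp [E', sub_eq_zero]
      have hlt : E' < E := by
        refine lt_of_le_of_ne inf_le_left fun h => ?_
        obtain ⟨x, hx, hne⟩ := hi μ
        exact hne ((hmem x).1 (h ▸ hx)).2
      obtain ⟨x, hx, hx0, hx1⟩ := ih _ (Submodule.finrank_lt_finrank_of_lt hlt) E' (by
          intro hb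
          have : (y : V) ∈ E' := (hmem _).2 ⟨y.2, hy1⟩
          rw [hb, Submodule.mem_bot] at this
          exact hy.2 (Subtype.ext this)) (by
          intro j x hx
          rw [hmem] at hx ⊢
          refine ⟨hst j x hx.1, ?_⟩
          have := congrArg (fun g => g x) (hcomm i j).eq
          simp only [Module.End.mul_apply] at this
          rw [this, hx.2, map_smul]) rfl
      exact ⟨x, ((hmem x).1 hx).1, hx0, hx1⟩

/-- Operators satisfying the braid relations and a weak quadratic relation have a common
eigenvector. -/
theorem exists_common_eigenvector_of_braid (T : ℕ → Module.End C V) (Q : V → Prop)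
    (hQ : ∀ i f, Q f → Q (T i f)) (hquad : ∀ i f, Q f → ∃ c : C, T i (T i f) = c • T i f)
    (hcomm : ∀ i j, i + 1 < j → Commute (T i) (T j))
    (hbraid : ∀ i, T i * T (i + 1) * T i = T (i + 1) * T i * T (i + 1))
    (e : V) (he : e ≠ 0) (hQe : Q e) (k : ℕ) :
    ∃ f, f ≠ 0 ∧ Q f ∧ ∀ i < k, ∃ c : C, T i f = c • f := by
  induction k with
  | zero => exact ⟨e, he, hQe, by simp⟩
  | succ k ih =>
    obtain ⟨e, he, hQe, heig⟩ := ih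
    have key : ∀ j f, j ≤ k → f ≠ 0 → Q f → (∀ i ≤ k, i ≠ j → ∃ c : C, T i f = c • f) →
        (j < k → ∃ g, f = T (j + 1) g ∧ ∃ c : C, T j g = c • g) →
        ∃ f, f ≠ 0 ∧ Q f ∧ ∀ i < k + 1, ∃ c : C, T i f = c • f := by
      intro j
      induction j with
      | zero =>
        intro f hj hf hQf hi hg
        by_cases h0 : T 0 f = 0
        · refine ⟨f, hf, hQf, fun i hik => ?_⟩
          rcases eq_or_ne i 0 with rfl | h
          · exact ⟨0, by rw [h0, zero_smul]⟩
          · exact hi i (by omega) h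
        · refine ⟨T 0 f, h0, hQ 0 f hQf, fun i hik => ?_⟩
          rcases Nat.lt_or_ge 1 i with h1 | h1
          · obtain ⟨c, hc⟩ := hi i (by omega) (by omega)
            refine ⟨c, ?_⟩
            rw [← Module.End.mul_apply, ← (hcomm 0 i h1).eq, Module.End.mul_apply, hc, map_smul]
          · interval_cases i
            · exact hquad 0 f hQf
            · obtain ⟨g, rfl, c, hc⟩ := hg (by omega)
              refine ⟨c, ?_⟩
              have := congrArg (fun φ => φ g) (hbraid 0)
              simp only [Module.End.mul_apply, zero_add] at this ⊢
              rw [← this, hc, map_smul, map_smul]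
      | succ j ihj =>
        intro f hj hf hQf hi hg
        by_cases h0 : T (j + 1) f = 0
        · refine ⟨f, hf, hQf, fun i hik => ?_⟩
          rcases eq_or_ne i (j + 1) with rfl | h
          · exact ⟨0, by rw [h0, zero_smul]⟩
          · exact hi i (by omega) h
        · refine ihj (T (j + 1) f) (by omega) h0 (hQ _ f hQf) (fun i hik hij => ?_)
            (fun _ => ⟨f, rfl, hi j (by omega) (by omega)⟩)
          rcases Nat.lt_or_ge (j + 2) i with h1 | h1
          · obtain ⟨c, hc⟩ := hi i (by omega) (by omega)
            refine ⟨c, ?_⟩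
            rw [← Module.End.mul_apply, ← (hcomm (j + 1) i h1).eq, Module.End.mul_apply, hc,
              map_smul]
          rcases Nat.lt_or_ge i j with h2 | h2
          · obtain ⟨c, hc⟩ := hi i (by omega) (by omega)
            refine ⟨c, ?_⟩
            rw [← Module.End.mul_apply, (hcomm i (j + 1) (by omega)).eq, Module.End.mul_apply, hc,
              map_smul]
          obtain rfl | rfl : i = j + 1 ∨ i = j + 1 + 1 := by omega
          · exact hquad _ f hQf
          · obtain ⟨g, rfl, c, hc⟩ := hg (by omega)
            refine ⟨c, ?_⟩
            have := congrArg (fun φ => φ g) (hbraid (j + 1))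
            simp only [Module.End.mul_apply] at this ⊢
            rw [← this, hc, map_smul, map_smul]
    exact key k e le_rfl he hQe (fun i hik hne => heig i (by omega)) (fun h => by omega)

/-- The subspace of vectors fixed by a subgroup. -/
def fixedBy {G : Type*} [Group G] (ρ : Representation C G V) (H : Subgroup G) :
    Submodule C V where
  carrier := {v | ∀ g ∈ H, ρ g v = v}
  add_mem' := fun hv hw g hg => by rw [map_add, hv g hg, hw g hg]
  zero_mem' := fun g _ => map_zero _
  smul_mem' := fun c v hv g hg => by rw [map_smul, hv g hg]

theorem mem_fixedBy {G : Type*} [Group G] {ρ : Representation C G V} {H : Subgroup G} {v : V} :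
    v ∈ fixedBy ρ H ↔ ∀ g ∈ H, ρ g v = v := Iff.rfl

/-- The kernel of the projection to the coinvariants of a subgroup. -/
def coinvKer {G : Type*} [Group G] (ρ : Representation C G V) (H : Subgroup G) :
    Submodule C V := Submodule.span C {x | ∃ g ∈ H, ∃ v : V, x = ρ g v - v}

/-- Every stable subspace is trivial. -/
def NoStable {G : Type*} [Group G] (ρ : Representation C G V) : Prop :=
  ∀ S : Submodule C V, (∀ g v, v ∈ S → ρ g v ∈ S) → S = ⊥ ∨ S = ⊤

theorem NoStable.finiteDimensional {G : Type*} [Group G] [Finite G] {ρ : Representation C G V}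
    (h : NoStable ρ) : FiniteDimensional C V := by
  rcases subsingleton_or_nontrivial V with _ | _
  · infer_instance
  obtain ⟨v, hv⟩ := exists_ne (0 : V)
  rcases h (Submodule.span C (Set.range fun g => ρ g v)) (by
    intro g x hx
    have : Submodule.span C (Set.range fun g => ρ g v) ≤
        (Submodule.span C (Set.range fun g => ρ g v)).comap (ρ g) := by
      refine Submodule.span_le.2 ?_
      rintro _ ⟨k, rfl⟩
      exact Submodule.subset_span ⟨g * k, by simp⟩
    exact this hx) with hb | ht
  · refine absurd ?_ hv
    have : v ∈ Submodule.span C (Set.range fun g => ρ g v) :=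
      Submodule.subset_span ⟨1, by simp⟩
    rwa [hb, Submodule.mem_bot] at this
  · exact ⟨(Submodule.fg_def).2 ⟨_, Set.finite_range _, ht⟩⟩

variable {F : Type*} [Field F] {n : ℕ}

/-- The contragredient representation twisted by inverse transposition. -/
def dualRep (ρ : Representation C (GL (Fin n) F) V) :
    Representation C (GL (Fin n) F) (Module.Dual C V) where
  toFun g := (ρ (trGL g)).dualMap
  map_one' := by ext; simp [trGL_one]
  map_mul' g h := by ext; simp [trGL_mul]

theorem dualRep_apply (ρ : Representation C (GL (Fin n) F) V) (g : GL (Fin n) F)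
    (l : Module.Dual C V) (x : V) : dualRep ρ g l x = l (ρ (trGL g) x) := rfl

theorem NoStable.dualRep [FiniteDimensional C V] {ρ : Representation C (GL (Fin n) F) V}
    (h : NoStable ρ) : NoStable (dualRep ρ) := by
  intro S hS
  have h1 := h S.dualCoannihilator (by
    intro g v hv
    rw [Submodule.mem_dualCoannihilator] at hv ⊢
    intro φ hφ
    have := hv _ (hS (trGL g) φ hφ)
    rwa [dualRep_apply, trGL_trGL] at this)
  have h2 := Subspace.dualCoannihilator_dualAnnihilator_eq (W := S)
  rcases h1 with h1 | h1
  · right; rw [← h2, h1, Submodule.dualAnnihilator_bot]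
  · left; rw [← h2, h1, Submodule.dualAnnihilator_top]

variable {α : Type*} [LinearOrder α]

theorem fixedBy_dualRep (ρ : Representation C (GL (Fin n) F) V) (b : Fin n → α) :
    fixedBy (dualRep ρ) (unip F b) =
      (coinvKer ρ (unip F (OrderDual.toDual ∘ b))).dualAnnihilator := by
  ext l
  rw [coinvKer, Submodule.mem_dualAnnihilator, mem_fixedBy]
  constructor
  · intro h w hw
    have : Submodule.span C {x | ∃ g ∈ unip F (OrderDual.toDual ∘ b), ∃ v : V, x = ρ g v - v} ≤
        LinearMap.ker l := by
      refine Submodule.span_le.2 ?_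
      rintro _ ⟨g, hg, v, rfl⟩
      have h1 := congrArg (fun φ => φ v) (h (trGL g) (trGL_mem_unip.2 hg))
      simp only [dualRep_apply, trGL_trGL] at h1
      simp [h1]
    exact this hw
  · intro h g hg
    ext v
    rw [dualRep_apply, ← sub_eq_zero, ← map_sub]
    refine h _ (Submodule.subset_span ⟨_, ?_, v, rfl⟩)
    rw [← trGL_mem_unip, trGL_trGL]; exact hg

theorem coinvKer_dualRep (ρ : Representation C (GL (Fin n) F) V) (b : Fin n → α) :
    (coinvKer (dualRep ρ) (unip F (OrderDual.toDual ∘ b))).dualCoannihilator =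
      fixedBy ρ (unip F b) := by
  ext x
  rw [coinvKer, Submodule.mem_dualCoannihilator, mem_fixedBy]
  constructor
  · intro h g hg
    rw [← sub_eq_zero, ← Module.forall_dual_apply_eq_zero_iff C]
    intro φ
    have h1 := h _ (Submodule.subset_span ⟨trGL g, trGL_mem_unip.1 (by rwa [trGL_trGL]), φ, rfl⟩)
    rw [LinearMap.sub_apply, dualRep_apply, trGL_trGL] at h1
    rw [map_sub, h1]
  · intro h φ hφ
    have : Submodule.span C {y | ∃ g ∈ unip F (OrderDual.toDual ∘ b), ∃ l : Module.Dual C V,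
        y = dualRep ρ g l - l} ≤ LinearMap.ker (Module.Dual.eval C V x) := by
      refine Submodule.span_le.2 ?_
      rintro _ ⟨g, hg, l, rfl⟩
      have h1 := h _ (trGL_mem_unip.2 hg)
      simp [dualRep_apply, h1]
    exact this hφ

end Linear

section Hecke

variable {C : Type*} [Field C] {V : Type*} [AddCommGroup V] [Module C V]
variable {F : Type*} [Field F] {n : ℕ}

theorem permGL_mul_elemGL_of {σ : Equiv.Perm (Fin n)} {i j k l : Fin n} (hij : i ≠ j)
    (hkl : k ≠ l) (hk : σ i = k) (hl : σ j = l) (a : F) :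
    permGL F σ * elemGL i j hij a = elemGL k l hkl a * permGL F σ := by
  subst hk hl
  exact permGL_mul_elemGL σ i j hij a

theorem swap_conj_elemGL (i j : Fin n) (hij : i ≠ j) (a : F) :
    permGL F (Equiv.swap i j) * elemGL i j hij a * permGL F (Equiv.swap i j) =
      elemGL j i hij.symm a := by
  rw [permGL_mul_elemGL_of hij hij.symm (Equiv.swap_apply_left i j) (Equiv.swap_apply_right i j),
    mul_assoc, permGL_swap_mul_self, mul_one]

/-- A common eigenvector of the diagonal matrices. -/
def IsTorusEigen (ρ : Representation C (GL (Fin n) F) V) (v : V) : Prop :=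
  ∀ t, ∃ c : C, ρ (diagGL t) v = c • v

/-- The lower elementary matrices act on eigenvectors through the reflection. -/
theorem exists_elemGL_swap_apply {ρ : Representation C (GL (Fin n) F) V} {v : V}
    (hv : v ∈ fixedBy ρ (unip F (id : Fin n → Fin n))) (ht : IsTorusEigen ρ v) {i j : Fin n}
    (hij : i < j) {a : F} (ha : a ≠ 0) :
    ∃ c : C, ρ (elemGL i j hij.ne a * permGL F (Equiv.swap i j)) v =
      c • ρ (elemGL j i hij.ne' a⁻¹) v := by
  obtain ⟨t, h⟩ := elemGL_mul_swap i j hij.ne (Units.mk0 a ha)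
  obtain ⟨c, hc⟩ := ht t
  refine ⟨c, ?_⟩
  rw [Units.val_mk0] at h
  rw [h, map_mul, map_mul, Module.End.mul_apply, Module.End.mul_apply,
    hv _ (elemGL_mem_unip hij.ne hij _), hc, map_smul, Units.val_inv_eq_inv_val, Units.val_mk0]

theorem exists_elemGL_apply {ρ : Representation C (GL (Fin n) F) V} {v : V}
    (hv : v ∈ fixedBy ρ (unip F (id : Fin n → Fin n))) (ht : IsTorusEigen ρ v) {i j : Fin n}
    (hij : i < j) {a : F} (ha : a ≠ 0) :
    ∃ c : C, ρ (elemGL j i hij.ne' a) v =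
      c • ρ (elemGL i j hij.ne a⁻¹ * permGL F (Equiv.swap i j)) v := by
  obtain ⟨c, hc⟩ := exists_elemGL_swap_apply hv ht hij (inv_ne_zero ha)
  rw [inv_inv] at hc
  rcases eq_or_ne c 0 with rfl | h0
  · rw [zero_smul] at hc
    have hv0 : v = 0 := by
      have := congrArg (ρ (elemGL i j hij.ne a⁻¹ * permGL F (Equiv.swap i j))⁻¹) hc
      rwa [← Module.End.mul_apply, ← map_mul, inv_mul_cancel, map_one, map_zero,
        Module.End.one_apply] at this
    exact ⟨0, by rw [hv0]; simp⟩
  · exact ⟨c⁻¹, by rw [hc, smul_smul, inv_mul_cancel₀ h0, one_smul]⟩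

variable [Fintype F]

/-- The Hecke operator of a reflection. -/
def heckeOp (ρ : Representation C (GL (Fin n) F) V) (i j : Fin n) (hij : i ≠ j) :
    Module.End C V := ∑ a : F, ρ (elemGL i j hij a * permGL F (Equiv.swap i j))

theorem heckeOp_apply (ρ : Representation C (GL (Fin n) F) V) (i j : Fin n) (hij : i ≠ j) (v : V) :
    heckeOp ρ i j hij v = ∑ a : F, ρ (elemGL i j hij a * permGL F (Equiv.swap i j)) v := by
  simp [heckeOp, LinearMap.sum_apply]

theorem heckeOp_mem_fixedBy {ρ : Representation C (GL (Fin n) F) V} {v : V}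
    (hv : v ∈ fixedBy ρ (unip F (id : Fin n → Fin n))) {i j : Fin n} (hne : i ≠ j)
    (hij : (i : ℕ) + 1 = j) :
    heckeOp ρ i j hne v ∈ fixedBy ρ (unip F (id : Fin n → Fin n)) := by
  intro u hu
  have hlt : i < j := Fin.lt_def.2 (by omega)
  rw [heckeOp_apply, map_sum]
  refine Fintype.sum_equiv (Equiv.addRight (u.1 i j)) _ _ fun a => ?_
  rw [Equiv.coe_addRight]
  set w := a + u.1 i j with hw
  have hmem : elemGL i j hne (-w) * u * elemGL i j hne a ∈ unip F (id : Fin n → Fin n) :=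
    mul_mem (mul_mem (elemGL_mem_unip hne hlt _) hu) (elemGL_mem_unip hne hlt _)
  have hu' := mem_unip.1 hu
  have h0 : (elemGL i j hne (-w) * u * elemGL i j hne a).1 i j = 0 := by
    rw [Units.val_mul, mul_elemGL_apply, Units.val_mul, elemGL_mul_apply, elemGL_mul_apply,
      if_pos rfl, if_pos rfl, if_pos rfl, hu' i i le_rfl, hu' j j le_rfl, hu' j i hlt.le,
      Matrix.one_apply_ne hne.symm, Matrix.one_apply_eq, Matrix.one_apply_eq]
    rw [hw]; ring
  have h1 := hv _ (swap_conj_mem_upper hij hmem h0)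
  rw [← Module.End.mul_apply, ← map_mul]
  have h2 : u * (elemGL i j hne a * permGL F (Equiv.swap i j)) =
      elemGL i j hne w * permGL F (Equiv.swap i j) *
      (permGL F (Equiv.swap i j) * (elemGL i j hne (-w) * u * elemGL i j hne a) *
        permGL F (Equiv.swap i j)) := by
    simp only [← mul_assoc]
    rw [mul_assoc _ (permGL F (Equiv.swap i j)) (permGL F (Equiv.swap i j)), permGL_swap_mul_self,
      mul_one, elemGL_mul_same, add_neg_cancel, elemGL_zero, one_mul]
  rw [h2, map_mul, Module.End.mul_apply, h1]

theorem heckeOp_isTorusEigen {ρ : Representation C (GL (Fin n) F) V} {v : V}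
    (hv : IsTorusEigen ρ v) {i j : Fin n} (hne : i ≠ j) : IsTorusEigen ρ (heckeOp ρ i j hne v) := by
  intro t
  obtain ⟨c, hc⟩ := hv (t ∘ Equiv.swap i j)
  refine ⟨c, ?_⟩
  rw [heckeOp_apply, map_sum, Finset.smul_sum]
  refine Fintype.sum_equiv ((Units.mulLeft (t i)).trans (Units.mulRight (t j)⁻¹)) _ _ fun a => ?_
  rw [← Module.End.mul_apply, ← map_mul, ← mul_assoc, diagGL_mul_elemGL, mul_assoc,
    diagGL_mul_permGL, ← mul_assoc, map_mul, Module.End.mul_apply, hc, map_smul]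
  simp

theorem heckeOp_heckeOp {ρ : Representation C (GL (Fin n) F) V} (hF : (Fintype.card F : C) = 0)
    {v : V} (hv : v ∈ fixedBy ρ (unip F (id : Fin n → Fin n))) (ht : IsTorusEigen ρ v)
    {i j : Fin n} (hij : i < j) :
    ∃ c : C, heckeOp ρ i j hij.ne (heckeOp ρ i j hij.ne v) = c • heckeOp ρ i j hij.ne v := by
  have key : ∀ b : F, ∃ c : C, heckeOp ρ i j hij.ne
      (ρ (elemGL i j hij.ne b * permGL F (Equiv.swap i j)) v) = c • heckeOp ρ i j hij.ne v := by
    intro b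
    rcases eq_or_ne b 0 with rfl | hb
    · refine ⟨0, ?_⟩
      rw [elemGL_zero, one_mul, zero_smul, heckeOp_apply]
      calc _ = ∑ a : F, v := Finset.sum_congr rfl fun a _ => by
            rw [← Module.End.mul_apply, ← map_mul, mul_assoc, permGL_swap_mul_self, mul_one,
              hv _ (elemGL_mem_unip hij.ne hij _)]
        _ = (Fintype.card F : C) • v := by simp [Nat.cast_smul_eq_nsmul]
        _ = 0 := by rw [hF, zero_smul]
    · obtain ⟨c, hc⟩ := exists_elemGL_apply hv ht hij hb
      refine ⟨c, ?_⟩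
      rw [heckeOp_apply, heckeOp_apply, Finset.smul_sum]
      refine Fintype.sum_equiv (Equiv.addRight b⁻¹) _ _ fun a => ?_
      rw [← Module.End.mul_apply, ← map_mul, mul_assoc, ← mul_assoc (permGL F _), swap_conj_elemGL,
        map_mul, Module.End.mul_apply, hc, map_smul, ← Module.End.mul_apply, ← map_mul,
        ← mul_assoc, elemGL_mul_same, Equiv.coe_addRight]
  choose c hc using key
  refine ⟨∑ b, c b, ?_⟩
  rw [Finset.sum_smul, ← Finset.sum_congr rfl fun b _ => hc b, ← map_sum, ← heckeOp_apply]

theorem heckeOp_commute (ρ : Representation C (GL (Fin n) F) V) {i j k l : Fin n} (hij : i ≠ j)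
    (hkl : k ≠ l) (hik : i ≠ k) (hil : i ≠ l) (hjk : j ≠ k) (hjl : j ≠ l) :
    Commute (heckeOp ρ i j hij) (heckeOp ρ k l hkl) := by
  have hs : permGL F (Equiv.swap i j) * permGL F (Equiv.swap k l) =
      permGL F (Equiv.swap k l) * permGL F (Equiv.swap i j) := by
    rw [← permGL_mul, ← permGL_mul]
    congr 1
    refine (Equiv.Perm.Disjoint.commute ?_).eq
    rw [Equiv.Perm.disjoint_iff_eq_or_eq]
    intro x
    by_cases h : x = i ∨ x = j
    · right; rcases h with rfl | rfl
      · exact Equiv.swap_apply_of_ne_of_ne hik hil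
      · exact Equiv.swap_apply_of_ne_of_ne hjk hjl
    · left; push Not at h; exact Equiv.swap_apply_of_ne_of_ne h.1 h.2
  rw [Commute, SemiconjBy, heckeOp, heckeOp, Finset.sum_mul_sum, Finset.sum_mul_sum,
    Finset.sum_comm]
  refine Finset.sum_congr rfl fun b _ => Finset.sum_congr rfl fun a _ => ?_
  rw [← map_mul, ← map_mul]
  congr 1
  rw [mul_assoc, ← mul_assoc _ (elemGL k l hkl b),
    permGL_mul_elemGL_of hkl hkl (Equiv.swap_apply_of_ne_of_ne hik.symm hjk.symm)
      (Equiv.swap_apply_of_ne_of_ne hil.symm hjl.symm), mul_assoc, ← mul_assoc, hs,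
    elemGL_comm i j hij k l hkl a b hil hjk, mul_assoc, mul_assoc,
    ← mul_assoc (elemGL i j hij a), ← mul_assoc (permGL F (Equiv.swap k l)),
    permGL_mul_elemGL_of hij hij (Equiv.swap_apply_of_ne_of_ne hik hil)
      (Equiv.swap_apply_of_ne_of_ne hjk hjl)]

theorem heckeOp_braid (ρ : Representation C (GL (Fin n) F) V) {p q r : Fin n} (hpq : p ≠ q)
    (hqr : q ≠ r) (hpr : p ≠ r) :
    heckeOp ρ p q hpq * heckeOp ρ q r hqr * heckeOp ρ p q hpq =
      heckeOp ρ q r hqr * heckeOp ρ p q hpq * heckeOp ρ q r hqr := by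
  set s := permGL F (Equiv.swap p q) with hs
  set t := permGL F (Equiv.swap q r) with ht
  have hw : s * t * s = t * s * t := by
    rw [hs, ht, ← permGL_mul, ← permGL_mul, ← permGL_mul, ← permGL_mul]
    congr 1
    rw [Equiv.swap_mul_swap_mul_swap hpq hpr, Equiv.swap_comm p q, Equiv.swap_comm q r,
      Equiv.swap_mul_swap_mul_swap hqr.symm hpr.symm, Equiv.swap_comm]
  have e1 : ∀ a, s * elemGL q r hqr a = elemGL p r hpr a * s := fun a =>
    permGL_mul_elemGL_of hqr hpr (by simp) (Equiv.swap_apply_of_ne_of_ne hpr.symm hqr.symm) a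
  have e2 : ∀ a, t * elemGL p q hpq a = elemGL p r hpr a * t := fun a =>
    permGL_mul_elemGL_of hpq hpr (Equiv.swap_apply_of_ne_of_ne hpq hpr) (by simp) a
  have e3 : ∀ a, s * elemGL p r hpr a = elemGL q r hqr a * s := fun a =>
    permGL_mul_elemGL_of hpr hqr (by simp) (Equiv.swap_apply_of_ne_of_ne hpr.symm hqr.symm) a
  have e4 : ∀ a, t * elemGL p r hpr a = elemGL p q hpq a * t := fun a =>
    permGL_mul_elemGL_of hpr hpq (Equiv.swap_apply_of_ne_of_ne hpq hpr) (by simp) a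
  have h1 : ∀ a b c, elemGL p q hpq a * s * (elemGL q r hqr b * t) * (elemGL p q hpq c * s) =
      elemGL p q hpq a * elemGL p r hpr b * elemGL q r hqr c * (s * t * s) := fun a b c => by
    calc _ = elemGL p q hpq a * (s * elemGL q r hqr b) * (t * elemGL p q hpq c) * s := by
          simp only [mul_assoc]
      _ = elemGL p q hpq a * elemGL p r hpr b * (s * elemGL p r hpr c) * t * s := by
          rw [e1, e2]; simp only [mul_assoc]
      _ = _ := by rw [e3]; simp only [mul_assoc]
  have h2 : ∀ a b c, elemGL q r hqr a * t * (elemGL p q hpq b * s) * (elemGL q r hqr c * t) =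
      elemGL q r hqr a * elemGL p r hpr b * elemGL p q hpq c * (t * s * t) := fun a b c => by
    calc _ = elemGL q r hqr a * (t * elemGL p q hpq b) * (s * elemGL q r hqr c) * t := by
          simp only [mul_assoc]
      _ = elemGL q r hqr a * elemGL p r hpr b * (t * elemGL p r hpr c) * s * t := by
          rw [e2, e1]; simp only [mul_assoc]
      _ = _ := by rw [e4]; simp only [mul_assoc]
  simp only [heckeOp, ← hs, ← ht, Finset.sum_mul, Finset.mul_sum, ← map_mul, h1, h2]
  rw [hw]
  simp only [elemGL_heis]
  rw [Finset.sum_congr rfl fun c _ => Finset.sum_comm, Finset.sum_comm]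
  refine Finset.sum_congr rfl fun a _ => ?_
  conv_rhs => rw [Finset.sum_comm]
  refine Finset.sum_congr rfl fun c _ => ?_
  exact Fintype.sum_equiv (Equiv.addRight (a * c)) _ _ fun b => rfl

end Hecke

section Good

variable {C : Type*} [Field C] {V : Type*} [AddCommGroup V] [Module C V]
variable {F : Type*} [Field F] {n : ℕ}

theorem diagGL_mul (s t : Fin n → Fˣ) : diagGL s * diagGL t = diagGL (s * t) :=
  Units.ext (by simp [diagGL])

/-- A vector fixed by the upper unipotent group, which is an eigenvector of the diagonal matrices
and generates the representation under the lower unipotent group. -/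
structure IsGood (ρ : Representation C (GL (Fin n) F) V) (v : V) : Prop where
  fixed : v ∈ fixedBy ρ (unip F (id : Fin n → Fin n))
  torus : IsTorusEigen ρ v
  span_eq_top : Submodule.span C {x | ∃ u ∈ unip F (OrderDual.toDual : Fin n → (Fin n)ᵒᵈ),
    x = ρ u v} = ⊤

variable [Fintype F]

/-- Simple reflections preserve the span of the lower unipotent translates of a Hecke
eigenvector. -/
theorem swap_apply_mem_span {ρ : Representation C (GL (Fin n) F) V} {v : V}
    (hv : v ∈ fixedBy ρ (unip F (id : Fin n → Fin n))) (ht : IsTorusEigen ρ v)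
    {i j : Fin n} (hij : (i : ℕ) + 1 = j) (hlt : i < j)
    (hT : ∃ c : C, heckeOp ρ i j hlt.ne v = c • v)
    {u : GL (Fin n) F} (hu : u ∈ unip F (OrderDual.toDual : Fin n → (Fin n)ᵒᵈ)) :
    ρ (permGL F (Equiv.swap i j)) (ρ u v) ∈
      Submodule.span C {x | ∃ u ∈ unip F (OrderDual.toDual : Fin n → (Fin n)ᵒᵈ), x = ρ u v} := by
  set Y := Submodule.span C {x | ∃ u ∈ unip F (OrderDual.toDual : Fin n → (Fin n)ᵒᵈ), x = ρ u v}
  set s := permGL F (Equiv.swap i j) with hs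
  have hY : ∀ u ∈ unip F (OrderDual.toDual : Fin n → (Fin n)ᵒᵈ), ρ u v ∈ Y := fun u hu =>
    Submodule.subset_span ⟨u, hu, rfl⟩
  have hYu : ∀ u ∈ unip F (OrderDual.toDual : Fin n → (Fin n)ᵒᵈ), ∀ x ∈ Y, ρ u x ∈ Y := by
    intro u hu x hx
    have : Y ≤ Y.comap (ρ u) := by
      refine Submodule.span_le.2 ?_
      rintro _ ⟨w, hw, rfl⟩
      rw [SetLike.mem_coe, Submodule.mem_comap, ← Module.End.mul_apply, ← map_mul]
      exact hY _ (mul_mem hu hw)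
    exact this hx
  have hy : ∀ a, elemGL j i hlt.ne' a ∈ unip F (OrderDual.toDual : Fin n → (Fin n)ᵒᵈ) :=
    fun a => elemGL_mem_unip hlt.ne' (OrderDual.toDual_lt_toDual.2 hlt) a
  have hne : ∀ a : F, a ≠ 0 → ρ (elemGL i j hlt.ne a * s) v ∈ Y := fun a ha => by
    obtain ⟨c, hc⟩ := exists_elemGL_swap_apply hv ht hlt ha
    rw [hc]
    exact Y.smul_mem _ (hY _ (hy _))
  have hsv : ρ s v ∈ Y := by
    obtain ⟨c, hc⟩ := hT
    rcases eq_or_ne c 0 with rfl | h0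
    · classical
      rw [zero_smul, heckeOp_apply, ← Finset.add_sum_erase _ _ (Finset.mem_univ 0), elemGL_zero,
        one_mul] at hc
      rw [eq_neg_of_add_eq_zero_left hc]
      exact Y.neg_mem (Submodule.sum_mem _ fun a ha => hne a (Finset.ne_of_mem_erase ha))
    · have h1 : v = c⁻¹ • heckeOp ρ i j hlt.ne v := by
        rw [hc, smul_smul, inv_mul_cancel₀ h0, one_smul]
      rw [h1, map_smul, heckeOp_apply, map_sum]
      refine Y.smul_mem _ (Submodule.sum_mem _ fun a _ => ?_)
      rw [← Module.End.mul_apply, ← map_mul, ← mul_assoc, swap_conj_elemGL]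
      exact hY _ (hy a)
  have hsy : ∀ a, ρ (s * elemGL j i hlt.ne' a) v ∈ Y := fun a => by
    rw [permGL_mul_elemGL_of hlt.ne' hlt.ne (Equiv.swap_apply_right i j)
      (Equiv.swap_apply_left i j)]
    rcases eq_or_ne a 0 with rfl | ha
    · rwa [elemGL_zero, one_mul]
    · exact hne a ha
  set m := u * elemGL j i hlt.ne' (-u.1 j i) with hm
  have hmem : m ∈ unip F (OrderDual.toDual : Fin n → (Fin n)ᵒᵈ) := mul_mem hu (hy _)
  have h0 : m.1 j i = 0 := by
    rw [hm, Units.val_mul, mul_elemGL_apply, if_pos rfl, mem_unip.1 hu j j le_rfl,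
      Matrix.one_apply_eq]
    ring
  have h1 : s * u = s * m * s * (s * elemGL j i hlt.ne' (u.1 j i)) := by
    rw [mul_assoc _ s, ← mul_assoc s s, permGL_swap_mul_self, one_mul, hm, mul_assoc, mul_assoc,
      elemGL_mul_same, neg_add_cancel, elemGL_zero, mul_one]
  rw [← Module.End.mul_apply, ← map_mul, h1, map_mul, Module.End.mul_apply]
  exact hYu _ (swap_conj_mem_lower hij hmem h0) _ (hsy _)

theorem isGood_of_heckeOp {ρ : Representation C (GL (Fin n) F) V} (h : NoStable ρ) {v : V}
    (hv0 : v ≠ 0) (hv : v ∈ fixedBy ρ (unip F (id : Fin n → Fin n))) (ht : IsTorusEigen ρ v)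
    (hT : ∀ (i j : Fin n) (hij : i < j), (i : ℕ) + 1 = j →
      ∃ c : C, heckeOp ρ i j hij.ne v = c • v) : IsGood ρ v := by
  refine ⟨hv, ht, ?_⟩
  set Y := Submodule.span C {x | ∃ u ∈ unip F (OrderDual.toDual : Fin n → (Fin n)ᵒᵈ), x = ρ u v}
  let H : Submonoid (GL (Fin n) F) :=
    { carrier := {g | Y ≤ Y.comap (ρ g)}
      one_mem' := fun x hx => by simpa using hx
      mul_mem' := fun {g k} hg hk x hx => by
        rw [Submodule.mem_comap, map_mul, Module.End.mul_apply]
        exact hg (hk hx) }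
  have hH : ∀ g, (∀ u ∈ unip F (OrderDual.toDual : Fin n → (Fin n)ᵒᵈ), ρ g (ρ u v) ∈ Y) →
      g ∈ H := by
    intro g hg
    refine Submodule.span_le.2 ?_
    rintro _ ⟨u, hu, rfl⟩
    exact hg u hu
  have hall := mem_of_generators H (fun t => hH _ fun u hu => by
      obtain ⟨c, hc⟩ := ht t
      have h1 : diagGL t * u = diagGL t * u * (diagGL t)⁻¹ * diagGL t := by simp
      rw [← Module.End.mul_apply, ← map_mul, h1, map_mul, Module.End.mul_apply, hc, map_smul]
      exact Y.smul_mem _ (Submodule.subset_span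
        ⟨_, conj_mem_unip (diagGL_mem_levi _ t).1 hu, rfl⟩))
    (fun i j hij => hH _ fun u hu => by
      have hlt : i < j := Fin.lt_def.2 (by omega)
      exact swap_apply_mem_span hv ht hij hlt (hT i j hlt hij) hu)
    (fun i j hij => Or.inr fun a => hH _ fun u hu => by
      rw [← Module.End.mul_apply, ← map_mul]
      exact Submodule.subset_span ⟨_, mul_mem (elemGL_mem_unip hij.ne'
        (OrderDual.toDual_lt_toDual.2 hij) a) hu, rfl⟩)
  refine (h Y fun g x hx => hall g hx).resolve_left fun hb => hv0 ?_
  have : v ∈ Y := Submodule.subset_span ⟨1, one_mem _, by simp⟩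
  rwa [hb, Submodule.mem_bot] at this

theorem exists_isGood [IsAlgClosed C] [Nontrivial V] (p : ℕ) [Fact p.Prime] [CharP C p]
    [CharP F p] (hF : (Fintype.card F : C) = 0) {ρ : Representation C (GL (Fin n) F) V}
    (h : NoStable ρ) : ∃ v, v ≠ 0 ∧ IsGood ρ v := by
  have := h.finiteDimensional
  obtain ⟨w, -, hw0, hw⟩ := exists_fixed_of_isPGroup ρ p _ (isPGroup_unip (F := F) (n := n) p) ⊤
    top_ne_bot (fun _ _ _ _ => trivial)
  obtain ⟨e, he, he0, het⟩ := exists_common_eigenvector (fun t : Fin n → Fˣ => ρ (diagGL t))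
    (fun s t => by
      rw [Commute, SemiconjBy, ← map_mul, ← map_mul, diagGL_mul, diagGL_mul, mul_comm])
    (fixedBy ρ (unip F (id : Fin n → Fin n)))
    (fun hb => hw0 (by
      have : w ∈ fixedBy ρ (unip F (id : Fin n → Fin n)) := hw
      rwa [hb, Submodule.mem_bot] at this))
    (fun t x hx g hg => by
      have h1 : g * diagGL t = diagGL t * ((diagGL t)⁻¹ * g * (diagGL t)⁻¹⁻¹) := by
        simp [mul_assoc]
      rw [← Module.End.mul_apply, ← map_mul, h1, map_mul, Module.End.mul_apply,
        hx _ (conj_mem_unip (inv_mem (diagGL_mem_levi _ t).1) hg)])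
  let T : ℕ → Module.End C V := fun k =>
    if hk : k + 1 < n then heckeOp ρ ⟨k, by omega⟩ ⟨k + 1, hk⟩ (by simp [Fin.ext_iff]) else 0
  have hT : ∀ k (hk : k + 1 < n),
      T k = heckeOp ρ ⟨k, by omega⟩ ⟨k + 1, hk⟩ (by simp [Fin.ext_iff]) := fun k hk => dif_pos hk
  have hT0 : ∀ k, ¬ k + 1 < n → T k = 0 := fun k hk => dif_neg hk
  obtain ⟨v, hv0, ⟨hv, hvt⟩, hve⟩ := exists_common_eigenvector_of_braid T
    (fun v => v ∈ fixedBy ρ (unip F (id : Fin n → Fin n)) ∧ IsTorusEigen ρ v)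
    (by
      rintro i f ⟨h1, h2⟩
      by_cases hi : i + 1 < n
      · rw [hT i hi]
        exact ⟨heckeOp_mem_fixedBy h1 _ rfl, heckeOp_isTorusEigen h2 _⟩
      · rw [hT0 i hi]
        exact ⟨Submodule.zero_mem _, fun t => ⟨0, by simp⟩⟩)
    (by
      rintro i f ⟨h1, h2⟩
      by_cases hi : i + 1 < n
      · rw [hT i hi]
        exact heckeOp_heckeOp hF h1 h2 (Fin.lt_def.2 (Nat.lt_succ_self i))
      · rw [hT0 i hi]
        exact ⟨0, by simp⟩)
    (by
      intro i j hij
      by_cases hj : j + 1 < n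
      · rw [hT i (by omega), hT j hj]
        apply heckeOp_commute <;> simp [Fin.ext_iff] <;> omega
      · rw [hT0 j hj]
        exact Commute.zero_right _)
    (by
      intro i
      by_cases hi : i + 1 + 1 < n
      · rw [hT i (by omega), hT (i + 1) hi]
        apply heckeOp_braid
        simp only [ne_eq, Fin.ext_iff]
        omega
      · rw [hT0 (i + 1) hi]
        simp)
    e he0 ⟨he, het⟩ n
  refine ⟨v, hv0, isGood_of_heckeOp h hv0 hv hvt fun i j hij hj => ?_⟩
  obtain ⟨i, hi⟩ := i
  obtain ⟨j, hj'⟩ := j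
  obtain rfl : i + 1 = j := hj
  have := hve i hi
  rwa [hT i hj'] at this

end Good

section Smith

variable {C : Type*} [Field C] {V : Type*} [AddCommGroup V] [Module C V]
variable {F : Type*} [Field F] {n : ℕ} {α : Type*} [LinearOrder α]

theorem unip_le_unip_id {b : Fin n → α} (hb : Monotone b) :
    unip F b ≤ unip F (id : Fin n → Fin n) := fun _ hg =>
  mem_unip.2 fun i j hij => mem_unip.1 hg i j (hb hij)

/-- The span of the translates of a vector under a Levi subgroup. -/
def leviSpan (ρ : Representation C (GL (Fin n) F) V) (b : Fin n → α) (v : V) : Submodule C V :=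
  Submodule.span C {x | ∃ m ∈ levi F b, x = ρ m v}

theorem leviSpan_le_fixedBy {ρ : Representation C (GL (Fin n) F) V} {v : V}
    (hv : v ∈ fixedBy ρ (unip F (id : Fin n → Fin n))) {b : Fin n → α} (hb : Monotone b) :
    leviSpan ρ b v ≤ fixedBy ρ (unip F b) := by
  refine Submodule.span_le.2 ?_
  rintro _ ⟨m, hm, rfl⟩ g hg
  have h1 : g * m = m * (m⁻¹ * g * m⁻¹⁻¹) := by simp [mul_assoc]
  rw [← Module.End.mul_apply, ← map_mul, h1, map_mul, Module.End.mul_apply,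
    hv _ (unip_le_unip_id hb (conj_mem_unip (inv_mem hm.1) hg))]

theorem IsGood.leviSpan_sup_coinvKer {ρ : Representation C (GL (Fin n) F) V} {v : V}
    (hv : IsGood ρ v) {b : Fin n → α} (hb : Monotone b) :
    leviSpan ρ b v ⊔ coinvKer ρ (unip F (OrderDual.toDual ∘ b)) = ⊤ := by
  rw [eq_top_iff, ← hv.span_eq_top]
  refine Submodule.span_le.2 ?_
  rintro _ ⟨u, hu, rfl⟩
  obtain ⟨g, hg, m, hm, rfl⟩ := exists_unip_mul_levi hb hu
  rw [map_mul, Module.End.mul_apply, ← add_sub_cancel (ρ m v) (ρ g (ρ m v))]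
  exact Submodule.add_mem_sup (Submodule.subset_span ⟨m, hm, rfl⟩)
    (Submodule.subset_span ⟨g, hg, _, rfl⟩)

/-- The invariants under the unipotent radical of a parabolic subgroup are generated by a good
vector under the Levi subgroup, both for a representation and for its dual. -/
theorem IsGood.leviSpan_eq [FiniteDimensional C V] {ρ : Representation C (GL (Fin n) F) V} {v : V}
    (hv : IsGood ρ v) {l : Module.Dual C V} (hl : IsGood (dualRep ρ) l) {b : Fin n → α}
    (hb : Monotone b) :
    leviSpan ρ b v = fixedBy ρ (unip F b) ∧
      leviSpan (dualRep ρ) b l = fixedBy (dualRep ρ) (unip F b) := by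
  have h1 := leviSpan_le_fixedBy hv.fixed hb
  have h2 := leviSpan_le_fixedBy hl.fixed hb
  have h3 := Submodule.finrank_add_le_finrank_add_finrank (leviSpan ρ b v)
    (coinvKer ρ (unip F (OrderDual.toDual ∘ b)))
  have h4 := Submodule.finrank_add_le_finrank_add_finrank (leviSpan (dualRep ρ) b l)
    (coinvKer (dualRep ρ) (unip F (OrderDual.toDual ∘ b)))
  rw [hv.leviSpan_sup_coinvKer hb, finrank_top] at h3
  rw [hl.leviSpan_sup_coinvKer hb, finrank_top, Subspace.dual_finrank_eq] at h4
  have h5 := Subspace.finrank_add_finrank_dualAnnihilator_eq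
    (coinvKer ρ (unip F (OrderDual.toDual ∘ b)))
  have h6 := Subspace.finrank_add_finrank_dualCoannihilator_eq
    (coinvKer (dualRep ρ) (unip F (OrderDual.toDual ∘ b)))
  rw [coinvKer_dualRep] at h6
  rw [← fixedBy_dualRep] at h5
  have h7 := Submodule.finrank_mono h1
  have h8 := Submodule.finrank_mono h2
  exact ⟨Submodule.eq_of_le_of_finrank_le h1 (by omega),
    Submodule.eq_of_le_of_finrank_le h2 (by omega)⟩

theorem IsGood.exists_eq_smul [FiniteDimensional C V] {ρ : Representation C (GL (Fin n) F) V}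
    {v : V} (hv : IsGood ρ v) {l : Module.Dual C V} (hl : IsGood (dualRep ρ) l) {x : V}
    (hx : x ∈ fixedBy ρ (unip F (id : Fin n → Fin n))) : ∃ c : C, x = c • v := by
  rw [← (hv.leviSpan_eq hl monotone_id).1] at hx
  have : leviSpan ρ (id : Fin n → Fin n) v ≤ C ∙ v := by
    refine Submodule.span_le.2 ?_
    rintro _ ⟨m, hm, rfl⟩
    obtain ⟨t, rfl⟩ := exists_eq_diagGL Function.injective_id hm
    obtain ⟨c, hc⟩ := hv.torus t
    exact Submodule.mem_span_singleton.2 ⟨c, hc.symm⟩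
  obtain ⟨c, hc⟩ := Submodule.mem_span_singleton.1 (this hx)
  exact ⟨c, hc.symm⟩

theorem apply_of_mem_lower {ρ : Representation C (GL (Fin n) F) V} {l : Module.Dual C V}
    (hl : IsGood (dualRep ρ) l) {u : GL (Fin n) F}
    (hu : u ∈ unip F (OrderDual.toDual : Fin n → (Fin n)ᵒᵈ)) (x : V) : l (ρ u x) = l x := by
  have h1 := congrArg (fun φ => φ x) (hl.fixed (trGL u) (trGL_mem_unip.2 hu))
  simpa only [dualRep_apply, trGL_trGL] using h1

theorem apply_ne_zero {ρ : Representation C (GL (Fin n) F) V} {v : V} (hv : IsGood ρ v)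
    {l : Module.Dual C V} (hl : IsGood (dualRep ρ) l) (hl0 : l ≠ 0) : l v ≠ 0 := by
  intro h
  apply hl0
  have : (⊤ : Submodule C V) ≤ LinearMap.ker l := by
    rw [← hv.span_eq_top]
    refine Submodule.span_le.2 ?_
    rintro _ ⟨u, hu, rfl⟩
    rw [SetLike.mem_coe, LinearMap.mem_ker, apply_of_mem_lower hl hu, h]
  exact LinearMap.ker_eq_top.1 (top_le_iff.1 this)

theorem exists_apply_lower {ρ : Representation C (GL (Fin n) F) V} {l : Module.Dual C V}
    (hl : IsGood (dualRep ρ) l) {x : GL (Fin n) F}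
    (hx : x ∈ para F (OrderDual.toDual : Fin n → (Fin n)ᵒᵈ)) :
    ∃ c : C, ∀ w, l (ρ x w) = c * l w := by
  have hd : ∀ i, x.1 i i ≠ 0 := by
    intro i hi
    refine (x.isUnit.map Matrix.detMonoidHom).ne_zero ?_
    rw [coe_detMonoidHom, det_of_isLowerTriangular _ hx]
    exact Finset.prod_eq_zero (Finset.mem_univ i) hi
  let t : Fin n → Fˣ := fun i => Units.mk0 _ (hd i)
  obtain ⟨c, hc⟩ := hl.torus t
  refine ⟨c, fun w => ?_⟩
  have hu : x * (diagGL t)⁻¹ ∈ unip F (OrderDual.toDual : Fin n → (Fin n)ᵒᵈ) := by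
    have h1 : StrictTriangular (OrderDual.toDual : Fin n → (Fin n)ᵒᵈ) (x.1 - (diagGL t).1) := by
      intro i j hij
      rw [Matrix.sub_apply, diagGL_apply]
      split_ifs with h
      · subst h; exact sub_self _
      · rw [hx (lt_of_le_of_ne hij fun h' => h (OrderDual.toDual.injective h').symm), sub_zero]
    have h2 := h1.mul_right ((para F _).inv_mem (diagGL_mem_levi _ t).1)
    rwa [sub_mul, ← Units.val_mul, ← Units.val_mul, mul_inv_cancel, Units.val_one] at h2
  have h1 : ρ x w = ρ (x * (diagGL t)⁻¹) (ρ (diagGL t) w) := by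
    rw [← Module.End.mul_apply, ← map_mul, inv_mul_cancel_right]
  have h2 := congrArg (fun φ => φ w) hc
  simp only [dualRep_apply, trGL_diagGL] at h2
  rw [h1, apply_of_mem_lower hl hu, h2]
  rfl

section Weyl

variable [Finite F] [FiniteDimensional C V] {ρ : Representation C (GL (Fin n) F) V} {v : V}
  {l : Module.Dual C V}

theorem swap_apply_of_descent (p : ℕ) [Fact p.Prime] [CharP C p] [CharP F p]
    (hv : IsGood ρ v) (hl : IsGood (dualRep ρ) l)
    {σ : Equiv.Perm (Fin n)} {i j : Fin n} (hij : (i : ℕ) + 1 = j) (hσ : σ j < σ i)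
    (h : l (ρ (permGL F σ) v) ≠ 0) : ∃ c : C, ρ (permGL F (Equiv.swap i j)) v = c • v := by
  have hlt : i < j := Fin.lt_def.2 (by omega)
  set s := permGL F (Equiv.swap i j) with hs
  let f : Module.Dual C V := l ∘ₗ ρ (permGL F σ)
  have hf : ∀ y, f y = l (ρ (permGL F σ) y) := fun _ => rfl
  have hfv : f v ≠ 0 := h
  let κ := f (ρ s v) / f v
  have hfx : f (ρ s v - κ • v) = 0 := by
    rw [map_sub, map_smul, smul_eq_mul, div_mul_cancel₀ _ hfv, sub_self]
  have hinv : ∀ a y, f (ρ (elemGL i j hlt.ne a) y) = f y := fun a y => by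
    rw [hf, ← Module.End.mul_apply, ← map_mul, permGL_mul_elemGL, map_mul, Module.End.mul_apply,
      apply_of_mem_lower hl (elemGL_mem_unip _ (OrderDual.toDual_lt_toDual.2 hσ) a), hf]
  refine ⟨κ, sub_eq_zero.1 ?_⟩
  by_contra hx
  let K : Submodule C V := ⨅ u : unip F (id : Fin n → Fin n), LinearMap.ker (f ∘ₗ ρ u)
  have hK : ∀ y, y ∈ K ↔ ∀ u ∈ unip F (id : Fin n → Fin n), f (ρ u y) = 0 := fun y => by
    simp [K, Submodule.mem_iInf]
  have hxK : ρ s v - κ • v ∈ K := by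
    rw [hK]
    intro u hu
    have hm : elemGL i j hlt.ne (-u.1 i j) * u ∈ unip F (id : Fin n → Fin n) :=
      mul_mem (elemGL_mem_unip hlt.ne hlt _) hu
    set m := elemGL i j hlt.ne (-u.1 i j) * u with hm'
    have h0 : m.1 i j = 0 := by
      rw [hm', Units.val_mul, elemGL_mul_apply, if_pos rfl, mem_unip.1 hu j j le_rfl,
        Matrix.one_apply_eq]
      ring
    have h1 : u = elemGL i j hlt.ne (u.1 i j) * m := by
      rw [hm', ← mul_assoc, elemGL_mul_same, add_neg_cancel, elemGL_zero, one_mul]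
    have h2 : m * s = s * (s * m * s) := by
      rw [← mul_assoc, ← mul_assoc, permGL_swap_mul_self, one_mul]
    have h3 : ρ m (ρ s v) = ρ s v := by
      rw [← Module.End.mul_apply, ← map_mul, h2, map_mul, Module.End.mul_apply,
        hv.fixed _ (swap_conj_mem_upper hij hm h0)]
    rw [h1, map_mul, Module.End.mul_apply, hinv, map_sub, map_smul, h3, hv.fixed m hm, hfx]
  obtain ⟨y, hyK, hy0, hy⟩ := exists_fixed_of_isPGroup ρ p _ (isPGroup_unip (F := F) (n := n) p) K
    (fun hb => hx (by rwa [hb, Submodule.mem_bot] at hxK))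
    (fun g hg y hy => by
      rw [hK] at hy ⊢
      intro u hu
      rw [← Module.End.mul_apply, ← map_mul]
      exact hy _ (mul_mem hu hg))
  obtain ⟨c, rfl⟩ := hv.exists_eq_smul hl hy
  have := (hK _).1 hyK 1 (one_mem _)
  rw [map_one, Module.End.one_apply, map_smul, smul_eq_mul, mul_eq_zero] at this
  rcases this with rfl | h0
  · exact hy0 (zero_smul _ _)
  · exact hfv h0

theorem permGL_apply_of_ne_zero (p : ℕ) [Fact p.Prime] [CharP C p] [CharP F p]
    (hv : IsGood ρ v) (hl : IsGood (dualRep ρ) l)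
    (σ : Equiv.Perm (Fin n)) (h : l (ρ (permGL F σ) v) ≠ 0) :
    ∃ c : C, ρ (permGL F σ) v = c • v := by
  induction hd : toLex (σ : Fin n → Fin n) using WellFoundedLT.induction generalizing σ with
  | _ d ih =>
    subst hd
    by_cases hdesc : ∃ i j : Fin n, (i : ℕ) + 1 = j ∧ σ j < σ i
    · obtain ⟨i, j, hij, hσ⟩ := hdesc
      obtain ⟨c, hc⟩ := swap_apply_of_descent p hv hl hij hσ h
      have h1 : permGL F σ = permGL F (σ * Equiv.swap i j) * permGL F (Equiv.swap i j) := by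
        rw [← permGL_mul, mul_assoc, Equiv.swap_mul_self, mul_one]
      rw [h1, map_mul, Module.End.mul_apply, hc, map_smul] at h ⊢
      obtain ⟨d, hd⟩ := ih _ (Pi.lex_desc (Fin.le_def.2 (by omega)) hσ) (σ * Equiv.swap i j)
        (fun h0 => h (by rw [map_smul, h0, smul_zero])) rfl
      exact ⟨c * d, by rw [hd, smul_smul]⟩
    · push Not at hdesc
      have hmono : StrictMono σ := by
        cases n with
        | zero => exact fun i => i.elim0
        | succ n =>
          refine Fin.strictMono_iff_lt_succ.2 fun i => ?_
          refine lt_of_le_of_ne (hdesc _ _ (by simp)) fun h => ?_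
          exact absurd (σ.injective h) (Fin.castSucc_lt_succ).ne
      have : σ = 1 := Equiv.ext fun x => congrFun ((hmono.range_inj strictMono_id).1
        (by rw [σ.surjective.range_eq, Set.range_id])) x
      exact ⟨1, by rw [this, permGL_one, map_one, one_smul]; rfl⟩

theorem exists_apply_notMem_coinvKer_iff (p : ℕ) [Fact p.Prime] [CharP C p] [CharP F p]
    (hv : IsGood ρ v) (hl : IsGood (dualRep ρ) l)
    (hl0 : l ≠ 0) {b b' : Fin n → α} (hb : Monotone b) (hb' : Monotone b') (g : GL (Fin n) F) :
    (∃ w ∈ fixedBy ρ (unip F b'), ρ g w ∉ coinvKer ρ (unip F (OrderDual.toDual ∘ b))) ↔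
      ∃ x ∈ para F (OrderDual.toDual ∘ b), ∃ y, (∃ c : C, ρ y v = c • v) ∧
        ∃ z ∈ para F b', g = x * y * z := by
  have hlv := apply_ne_zero hv hl hl0
  constructor
  · rintro ⟨w, hw, hwc⟩
    rw [← (hv.leviSpan_eq hl hb').1] at hw
    obtain ⟨m', hm', hmc⟩ : ∃ m' ∈ levi F b',
        ρ g (ρ m' v) ∉ coinvKer ρ (unip F (OrderDual.toDual ∘ b)) := by
      by_contra! hcon
      have : leviSpan ρ b' v ≤ (coinvKer ρ (unip F (OrderDual.toDual ∘ b))).comap (ρ g) := by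
        refine Submodule.span_le.2 ?_
        rintro _ ⟨m, hm, rfl⟩
        exact hcon m hm
      exact hwc (this hw)
    obtain ⟨m, hm, hmm⟩ : ∃ m ∈ levi F b, dualRep ρ m l (ρ g (ρ m' v)) ≠ 0 := by
      by_contra! hcon
      have h1 : leviSpan (dualRep ρ) b l ≤
          LinearMap.ker (Module.Dual.eval C V (ρ g (ρ m' v))) := by
        refine Submodule.span_le.2 ?_
        rintro _ ⟨m, hm, rfl⟩
        exact hcon m hm
      rw [(hv.leviSpan_eq hl hb).2, fixedBy_dualRep] at h1
      refine hmc ?_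
      rw [← Subspace.dualAnnihilator_dualCoannihilator_eq
        (W := coinvKer ρ (unip F (OrderDual.toDual ∘ b))), Submodule.mem_dualCoannihilator]
      exact fun φ hφ => h1 hφ
    obtain ⟨x, hx, σ, u, hu, hxu⟩ := exists_bruhat (trGL m * g * m')
    have h1 : l (ρ (trGL m * g * m') v) ≠ 0 := by
      rw [map_mul, map_mul, Module.End.mul_apply, Module.End.mul_apply]
      exact hmm
    obtain ⟨c, hc⟩ := exists_apply_lower hl hx
    rw [hxu, map_mul, map_mul, Module.End.mul_apply, Module.End.mul_apply, hv.fixed u hu, hc] at h1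
    refine ⟨(trGL m)⁻¹ * x, mul_mem (inv_mem (trGL_mem_levi hm).2) ?_, permGL F σ,
      permGL_apply_of_ne_zero p hv hl σ (right_ne_zero_of_mul h1), u * m'⁻¹,
      mul_mem ?_ (inv_mem hm'.1), ?_⟩
    · intro i j hij
      exact hx (lt_of_not_ge fun h => not_le_of_gt hij (hb h))
    · intro i j hij
      exact unip_le_para _ hu (lt_of_not_ge fun h => not_le_of_gt hij (hb' h))
    · have : g = (trGL m)⁻¹ * (trGL m * g * m') * m'⁻¹ := by group
      rw [this, hxu]; group
  · rintro ⟨x, hx, y, ⟨c, hc⟩, z, hz, rfl⟩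
    refine ⟨ρ z⁻¹ v, fun g hg => ?_, fun hmem => hlv ?_⟩
    · have h1 : g * z⁻¹ = z⁻¹ * (z * g * z⁻¹) := by group
      rw [← Module.End.mul_apply, ← map_mul, h1, map_mul, Module.End.mul_apply,
        hv.fixed _ (unip_le_unip_id hb' (conj_mem_unip hz hg))]
    · have h1 : coinvKer ρ (unip F (OrderDual.toDual ∘ b)) ≤ LinearMap.ker (l ∘ₗ ρ x⁻¹) := by
        refine Submodule.span_le.2 ?_
        rintro _ ⟨g, hg, w, rfl⟩
        have h2 : x⁻¹ * g = x⁻¹ * g * x⁻¹⁻¹ * x⁻¹ := by group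
        have h3 : x⁻¹ * g * x⁻¹⁻¹ ∈ unip F (OrderDual.toDual : Fin n → (Fin n)ᵒᵈ) := by
          refine mem_unip.2 fun i j hij => ?_
          exact mem_unip.1 (conj_mem_unip (inv_mem hx) hg) i j (hb hij)
        rw [SetLike.mem_coe, LinearMap.mem_ker, LinearMap.comp_apply, map_sub, map_sub,
          ← Module.End.mul_apply, ← map_mul, h2, map_mul, Module.End.mul_apply,
          apply_of_mem_lower hl h3, sub_self]
      have h2 := h1 hmem
      have h3 : x⁻¹ * (x * y * z * z⁻¹) = y := by group
      rw [LinearMap.mem_ker, LinearMap.comp_apply, ← Module.End.mul_apply, ← map_mul,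
        ← Module.End.mul_apply, ← map_mul, mul_assoc, h3, hc, map_smul, smul_eq_mul,
        mul_eq_zero] at h2
      refine h2.resolve_left fun h0 => hlv ?_
      rw [h0, zero_smul] at hc
      have h4 := congrArg (ρ y⁻¹) hc
      rw [← Module.End.mul_apply, ← map_mul, inv_mul_cancel, map_one, map_zero,
        Module.End.one_apply] at h4
      rw [h4, map_zero]

end Weyl

end Smith

end GLRep

/-!
STATEMENT 12.  Same setting as Statement 11 (`G = GL_n(F_q)`, `V` irreducible over an
algebraically closed field `C` of characteristic `p`).  Two compositions of `n` are encoded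
by monotone block functions `b, b' : Fin n → ℕ`; `b` determines `P = MN`, `P̄ = MN̄`, and
`b'` determines a second standard parabolic `P' = M'N'`.

Claim: for `g ∈ G`, the image of `g·V^{N'}` in `V_{N̄}` is nonzero iff `g ∈ P̄ · P_V · P'`.
-/
theorem statement12 (p : ℕ) (hp : p.Prime) (q r : ℕ) (hr : 0 < r) (hq : q = p ^ r)
    (𝔽 : Type) [Field 𝔽] [Fintype 𝔽] (hcard : Fintype.card 𝔽 = q)
    (C : Type) [Field C] [IsAlgClosed C] (hC : CharP C p)
    (n : ℕ) (hn : 1 ≤ n)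
    (V : Type) [AddCommGroup V] [Module C V] [Nontrivial V]
    (ρ : Representation C (GL (Fin n) 𝔽) V)
    (hirr : ∀ S : Submodule C V, (∀ (g : GL (Fin n) 𝔽) (v : V), v ∈ S → ρ g v ∈ S) →
      S = ⊥ ∨ S = ⊤)
    (b b' : Fin n → ℕ) (hb : Monotone b) (hb' : Monotone b') :
    -- the full upper unitriangular subgroup U
    let U : Set (GL (Fin n) 𝔽) :=
      {g | (∀ i j : Fin n, j < i → (↑g : Matrix (Fin n) (Fin n) 𝔽) i j = 0) ∧
        ∀ i : Fin n, (↑g : Matrix (Fin n) (Fin n) 𝔽) i i = 1}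
    -- the opposite parabolic P̄ attached to b (block lower triangular)
    let Pbar : Set (GL (Fin n) 𝔽) :=
      {g | ∀ i j : Fin n, b i < b j → (↑g : Matrix (Fin n) (Fin n) 𝔽) i j = 0}
    -- the opposite unipotent radical N̄ attached to b
    let Nbar : Set (GL (Fin n) 𝔽) :=
      {g | (∀ i j : Fin n, b i < b j → (↑g : Matrix (Fin n) (Fin n) 𝔽) i j = 0) ∧
        ∀ i j : Fin n, b i = b j →
          (↑g : Matrix (Fin n) (Fin n) 𝔽) i j = if i = j then (1 : 𝔽) else 0}
    -- the standard parabolic P' attached to b' (block upper triangular)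
    let P' : Set (GL (Fin n) 𝔽) :=
      {g | ∀ i j : Fin n, b' j < b' i → (↑g : Matrix (Fin n) (Fin n) 𝔽) i j = 0}
    -- the unipotent radical N' of P' (block upper unitriangular)
    let N' : Set (GL (Fin n) 𝔽) :=
      {g | (∀ i j : Fin n, b' j < b' i → (↑g : Matrix (Fin n) (Fin n) 𝔽) i j = 0) ∧
        ∀ i j : Fin n, b' i = b' j →
          (↑g : Matrix (Fin n) (Fin n) 𝔽) i j = if i = j then (1 : 𝔽) else 0}
    -- V^U
    let fixU : Submodule C V :=
      { carrier := {v | ∀ g ∈ U, ρ g v = v}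
        add_mem' := by intro v w hv hw g hg; rw [map_add, hv g hg, hw g hg]
        zero_mem' := by intro g hg; rw [map_zero]
        smul_mem' := by intro c v hv g hg; rw [_root_.map_smul, hv g hg] }
    -- V^{N'}
    let fixN' : Submodule C V :=
      { carrier := {v | ∀ g ∈ N', ρ g v = v}
        add_mem' := by intro v w hv hw g hg; rw [map_add, hv g hg, hw g hg]
        zero_mem' := by intro g hg; rw [map_zero]
        smul_mem' := by intro c v hv g hg; rw [_root_.map_smul, hv g hg] }
    -- the subspace of V defining the coinvariants V_{N̄} = V / coinvN
    let coinvN : Submodule C V :=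
      Submodule.span C {x | ∃ g ∈ Nbar, ∃ v : V, x = ρ g v - v}
    -- P_V, the stabilizer of V^U
    let PV : Set (GL (Fin n) 𝔽) :=
      {g | Submodule.map (ρ g : V →ₗ[C] V) fixU = fixU}
    ∀ g : GL (Fin n) 𝔽,
      (∃ v ∈ fixN', Submodule.Quotient.mk (p := coinvN) (ρ g v) ≠ 0) ↔
      ∃ x ∈ Pbar, ∃ y ∈ PV, ∃ z ∈ P', g = x * y * z := by
  intro U Pbar Nbar P' N' fixU fixN' coinvN PV g
  have := Fact.mk hp
  have hchar : CharP 𝔽 p := charP_of_card_eq_prime_pow (hcard.trans hq)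
  have hF : (Fintype.card 𝔽 : C) = 0 := by
    rw [hcard, hq, Nat.cast_pow, CharP.cast_eq_zero, zero_pow hr.ne']
  have hns : GLRep.NoStable ρ := hirr
  have := hns.finiteDimensional
  obtain ⟨v, hv0, hv⟩ := GLRep.exists_isGood p hF hns
  obtain ⟨l, hl0, hl⟩ := GLRep.exists_isGood p hF hns.dualRep
  have hU : fixU = GLRep.fixedBy ρ (GLRep.unip 𝔽 (id : Fin n → Fin n)) := by
    ext x
    refine forall_congr' fun g => imp_congr_left ?_
    refine Iff.trans ?_ GLRep.mem_unip_iff.symm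
    refine and_congr_right' ⟨fun h i j hij => ?_, fun h i => ?_⟩
    · obtain rfl : i = j := hij
      rw [h, if_pos rfl]
    · rw [h i i rfl, if_pos rfl]
  have hN' : fixN' = GLRep.fixedBy ρ (GLRep.unip 𝔽 b') := by
    ext x
    refine forall_congr' fun g => imp_congr_left ?_
    exact GLRep.mem_unip_iff.symm
  have hNbar : coinvN = GLRep.coinvKer ρ (GLRep.unip 𝔽 (OrderDual.toDual ∘ b)) := by
    refine congrArg (Submodule.span C) (Set.ext fun x => exists_congr fun g => and_congr_left' ?_)
    exact (GLRep.mem_unip_iff (b := OrderDual.toDual ∘ b)).symm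
  have hPV : ∀ y, y ∈ PV ↔ ∃ c : C, ρ y v = c • v := by
    intro y
    change Submodule.map (ρ y) fixU = fixU ↔ _
    have hspan : fixU = C ∙ v := by
      rw [hU]
      refine le_antisymm (fun x hx => ?_) ((Submodule.span_singleton_le_iff_mem _ _).2 hv.fixed)
      obtain ⟨c, rfl⟩ := hv.exists_eq_smul hl hx
      exact Submodule.smul_mem _ _ (Submodule.mem_span_singleton_self v)
    rw [hspan, Submodule.map_span, Set.image_singleton]
    constructor
    · intro h
      obtain ⟨c, hc⟩ := Submodule.mem_span_singleton.1
        (h ▸ Submodule.mem_span_singleton_self (ρ y v))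
      exact ⟨c, hc.symm⟩
    · rintro ⟨c, hc⟩
      have hc0 : c ≠ 0 := by
        rintro rfl
        rw [zero_smul] at hc
        refine hv0 ?_
        have h1 := congrArg (ρ y⁻¹) hc
        rwa [← Module.End.mul_apply, ← map_mul, inv_mul_cancel, map_one, map_zero,
          Module.End.one_apply] at h1
      rw [hc, Submodule.span_singleton_smul_eq (Ne.isUnit hc0)]
  have := GLRep.exists_apply_notMem_coinvKer_iff p hv hl hl0 hb hb' g
  simp only [hN', hNbar, ne_eq, Submodule.Quotient.mk_eq_zero, hPV]
  exact this
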